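/- arXiv:2507.00618 — 3 statements merged into one kernel-verified Lean document; each statement's English description precedes it below -/
import Mathlib

section
/- Let Λ ⊂ ℝ² be a discrete set with N_ρ = #(Λ ∩ (ρ + [0,1]²)) ≥ 1 for every ρ ∈ ℝ², and let h ∈ L¹(ℝ²) have continuous mixed partial derivatives ∂₁h, ∂₂h, ∂₁₂h lying in L¹(ℝ²). Then the weighted quadrature error e(h,Λ) = ∫_{ℝ²} h(ρ) dρ − Σ_{λ∈Λ} a_λ h(λ) satisfies |e(h,Λ)| ≤ ∫_{ℝ²} |e_ρ(h,Λ)| dρ ≤ D*_shift(Λ) · [ ‖∂₁h‖_{L¹(ℝ²)} + ‖∂₂h‖_{L¹(ℝ²)} + ‖∂₁₂h‖_{L¹(ℝ²)} ]. -/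
open MeasureTheory Set Real

noncomputable section

abbrev Pt : Type := ℝ × ℝ

/-- Number of points of `Λ` in the translated unit square `ρ + [0,1]²`. -/
def nPts (Λ : Set Pt) (ρ : Pt) : ℕ := (Λ ∩ Icc ρ (ρ + 1)).ncard

/-- Star discrepancy of `Λ` anchored at `ρ`:
`D*_ρ(Λ) = sup_{η ∈ [0,1]²} | #(Λ ∩ (ρ + [0,η]))/N_ρ − η₁η₂ |`. -/
def starDiscAt (Λ : Set Pt) (ρ : Pt) : ℝ :=
  ⨆ η : Icc (0 : Pt) 1,
    |((Λ ∩ Icc ρ (ρ + (η : Pt))).ncard : ℝ) / (nPts Λ ρ : ℝ) - (η : Pt).1 * (η : Pt).2|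

/-- Shifted star discrepancy `D*_shift(Λ) = sup_ρ D*_ρ(Λ)`. -/
def starDiscShift (Λ : Set Pt) : ℝ := ⨆ ρ : Pt, starDiscAt Λ ρ

/-- Quadrature weight `a_λ = ∫_{ℝ²} χ_{ρ+[0,1]²}(λ)/N_ρ dρ`. -/
def qweight (Λ : Set Pt) (p : Pt) : ℝ :=
  ∫ ρ : Pt, (Icc ρ (ρ + 1)).indicator (fun _ => (1 : ℝ)) p / (nPts Λ ρ : ℝ)

/-- Partial derivative in the first coordinate. -/
def d1 (h : Pt → ℂ) (x : Pt) : ℂ := deriv (fun s => h (s, x.2)) x.1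

/-- Partial derivative in the second coordinate. -/
def d2 (h : Pt → ℂ) (x : Pt) : ℂ := deriv (fun t => h (x.1, t)) x.2

/-- Mixed partial derivative `∂₁∂₂`. -/
def d12 (h : Pt → ℂ) : Pt → ℂ := d1 (d2 h)

/-- `h` has continuous (mixed) partial derivatives `∂₁h`, `∂₂h`, `∂₁₂h` on all of `ℝ²`. -/
def HasContMixedPartials (h : Pt → ℂ) : Prop :=
  Continuous h ∧
  (∀ x : Pt, DifferentiableAt ℝ (fun s => h (s, x.2)) x.1) ∧
  (∀ x : Pt, DifferentiableAt ℝ (fun t => h (x.1, t)) x.2) ∧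
  (∀ x : Pt, DifferentiableAt ℝ (fun s => d2 h (s, x.2)) x.1) ∧
  Continuous (d1 h) ∧ Continuous (d2 h) ∧ Continuous (d12 h)

/-- Local quadrature error on `ρ + [0,1]²`. -/
def localErr (Λ : Set Pt) (h : Pt → ℂ) (ρ : Pt) : ℂ :=
  (∫ η in Icc ρ (ρ + 1), h η) -
    (nPts Λ ρ : ℂ)⁻¹ * ∑' p : ↥(Λ ∩ Icc ρ (ρ + 1)), h (p : Pt)

/-- Global weighted quadrature error `e(h,Λ) = ∫ h − Σ_λ a_λ h(λ)`. -/
def quadErr (Λ : Set Pt) (h : Pt → ℂ) : ℂ :=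
  (∫ ρ : Pt, h ρ) - ∑' p : ↥Λ, (qweight Λ (p : Pt) : ℂ) * h (p : Pt)


/-- One-dimensional Taylor formula anchored at the right end point of `[r, r + 1]`. -/
lemma eq_sub_setIntegral_indicator_deriv {f f' : ℝ → ℂ} (hf : ∀ x, HasDerivAt f (f' x) x)
    (hc : Continuous f') {r x : ℝ} (hx : x ∈ Icc r (r + 1)) :
    f x = f (r + 1) - ∫ u in Icc (0 : ℝ) 1, (Ici x).indicator f' (r + u) := by
  have hind : ∀ u, (Ici x).indicator f' (r + u) =
      (Ici (x - r)).indicator (fun u => f' (r + u)) u := fun u => by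
    simp only [indicator, mem_Ici, sub_le_iff_le_add']
  have hset : Icc (0 : ℝ) 1 ∩ Ici (x - r) = Icc (x - r) 1 := by
    ext u
    simp only [mem_inter_iff, mem_Icc, mem_Ici]
    constructor
    · rintro ⟨⟨-, h1⟩, h2⟩
      exact ⟨h2, h1⟩
    · rintro ⟨h2, h1⟩
      exact ⟨⟨(sub_nonneg.2 hx.1).trans h2, h1⟩, h2⟩
  simp_rw [hind]
  rw [setIntegral_indicator measurableSet_Ici, hset, integral_Icc_eq_integral_Ioc,
    ← intervalIntegral.integral_of_le (by linarith [hx.2]),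
    intervalIntegral.integral_comp_add_left f' r, add_sub_cancel,
    intervalIntegral.integral_eq_sub_of_hasDerivAt (fun y _ => hf y) (hc.intervalIntegrable _ _),
    sub_sub_cancel]

/-- Two-dimensional Taylor formula anchored at the upper right corner of `ρ + [0,1]²`. -/
lemma HasContMixedPartials.eq_anchored {h : Pt → ℂ} (hsm : HasContMixedPartials h) {ρ p : Pt}
    (hp : p ∈ Icc ρ (ρ + 1)) :
    h p = h (ρ + 1) - (∫ u in Icc (0 : ℝ) 1, (Ici p).indicator (d1 h) (ρ + (u, 1)))
      - (∫ v in Icc (0 : ℝ) 1, (Ici p).indicator (d2 h) (ρ + (1, v)))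
      + ∫ η in Icc (0 : Pt) 1, (Ici p).indicator (d12 h) (ρ + η) := by
  obtain ⟨-, hd1, hd2, hd12, hc1, hc2, hc12⟩ := hsm
  obtain ⟨r₁, r₂⟩ := ρ
  obtain ⟨x, y⟩ := p
  have hx : x ∈ Icc r₁ (r₁ + 1) := ⟨hp.1.1, hp.2.1⟩
  have hy : y ∈ Icc r₂ (r₂ + 1) := ⟨hp.1.2, hp.2.2⟩
  have key₁ : h (x, r₂ + 1) = h (r₁ + 1, r₂ + 1) -
      ∫ u in Icc (0 : ℝ) 1, (Ici x).indicator (fun s => d1 h (s, r₂ + 1)) (r₁ + u) :=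
    eq_sub_setIntegral_indicator_deriv (f := fun s => h (s, r₂ + 1))
      (f' := fun s => d1 h (s, r₂ + 1))
      (fun s => (hd1 (s, r₂ + 1)).hasDerivAt) (by fun_prop) hx
  have key₂ : h (x, y) = h (x, r₂ + 1) -
      ∫ v in Icc (0 : ℝ) 1, (Ici y).indicator (fun t => d2 h (x, t)) (r₂ + v) :=
    eq_sub_setIntegral_indicator_deriv (f := fun t => h (x, t)) (f' := fun t => d2 h (x, t))
      (fun t => (hd2 (x, t)).hasDerivAt) (by fun_prop) hy
  have key₃ : ∀ t, d2 h (x, t) = d2 h (r₁ + 1, t) -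
      ∫ u in Icc (0 : ℝ) 1, (Ici x).indicator (fun s => d12 h (s, t)) (r₁ + u) := fun t =>
    eq_sub_setIntegral_indicator_deriv (f := fun s => d2 h (s, t)) (f' := fun s => d12 h (s, t))
      (fun s => (hd12 (s, t)).hasDerivAt) (by fun_prop) hx
  have hmem : ∀ s t : ℝ, (s, t) ∈ Ici (x, y) ↔ s ∈ Ici x ∧ t ∈ Ici y := fun s t => Iff.rfl
  have hind : ∀ u v : ℝ, (Ici (x, y)).indicator (d12 h) ((r₁, r₂) + (u, v)) =
      (Ici y).indicator
        (fun t => (Ici x).indicator (fun s => d12 h (s, t)) (r₁ + u)) (r₂ + v) := by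
    intro u v
    by_cases h₁ : r₁ + u ∈ Ici x <;> by_cases h₂ : r₂ + v ∈ Ici y <;>
      simp [indicator, Prod.mk_add_mk, hmem, h₁, h₂, -mem_Ici]
  have hint : IntegrableOn (fun η : Pt => (Ici (x, y)).indicator (d12 h) ((r₁, r₂) + η))
      (Icc (0 : ℝ) 1 ×ˢ Icc (0 : ℝ) 1) := by
    have : Continuous fun η : Pt => d12 h ((r₁, r₂) + η) := by fun_prop
    have hi := (this.continuousOn (s := Icc (0 : ℝ) 1 ×ˢ Icc (0 : ℝ) 1)).integrableOn_compact
      (μ := volume) (isCompact_Icc.prod isCompact_Icc)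
    exact hi.indicator (measurableSet_Ici.preimage (measurable_const_add (r₁, r₂)))
  have hdouble : ∫ η in Icc (0 : Pt) 1, (Ici (x, y)).indicator (d12 h) ((r₁, r₂) + η) =
      ∫ v in Icc (0 : ℝ) 1, ∫ u in Icc (0 : ℝ) 1,
        (Ici (x, y)).indicator (d12 h) ((r₁, r₂) + (u, v)) := by
    have hI : Icc (0 : Pt) 1 = Icc (0 : ℝ) 1 ×ˢ Icc (0 : ℝ) 1 := (Icc_prod_Icc _ _ _ _).symm
    rw [hI, Measure.volume_eq_prod, ← Measure.prod_restrict]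
    refine integral_prod_symm _ ?_
    rwa [Measure.prod_restrict, ← Measure.volume_eq_prod]
  have hinner : ∀ v : ℝ, (Ici y).indicator (fun t => d2 h (x, t)) (r₂ + v) =
      (Ici (x, y)).indicator (d2 h) ((r₁, r₂) + (1, v)) -
      ∫ u in Icc (0 : ℝ) 1, (Ici (x, y)).indicator (d12 h) ((r₁, r₂) + (u, v)) := by
    intro v
    simp_rw [hind]
    by_cases h₂ : r₂ + v ∈ Ici y
    · have : (r₁ + 1, r₂ + v) ∈ Ici (x, y) := ⟨hx.2, h₂⟩
      simp only [indicator_of_mem h₂, Prod.mk_add_mk, indicator_of_mem this]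
      exact key₃ _
    · have : (r₁ + 1, r₂ + v) ∉ Ici (x, y) := fun hh => h₂ hh.2
      simp only [indicator_of_notMem h₂, Prod.mk_add_mk, indicator_of_notMem this]
      simp
  have hfirst : ∀ u : ℝ, (Ici (x, y)).indicator (d1 h) ((r₁, r₂) + (u, 1)) =
      (Ici x).indicator (fun s => d1 h (s, r₂ + 1)) (r₁ + u) := by
    intro u
    have : r₂ + 1 ∈ Ici y := hy.2
    simp [indicator, Prod.mk_add_mk, hmem, -mem_Ici, this]
  have hone : ((r₁, r₂) : Pt) + 1 = (r₁ + 1, r₂ + 1) := rfl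
  have hint₂ : IntegrableOn (fun v : ℝ => (Ici (x, y)).indicator (d2 h) ((r₁, r₂) + (1, v)))
      (Icc (0 : ℝ) 1) := by
    have : Continuous fun v : ℝ => d2 h ((r₁, r₂) + (1, v)) := by fun_prop
    have hm : Measurable fun v : ℝ => ((r₁, r₂) : Pt) + (1, v) := by fun_prop
    exact ((this.continuousOn (s := Icc (0 : ℝ) 1)).integrableOn_compact
      (μ := volume) isCompact_Icc).indicator (measurableSet_Ici.preimage hm)
  have hint₃ : IntegrableOn (fun v : ℝ => ∫ u in Icc (0 : ℝ) 1,
      (Ici (x, y)).indicator (d12 h) ((r₁, r₂) + (u, v))) (Icc (0 : ℝ) 1) := by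
    rw [IntegrableOn, Measure.volume_eq_prod, ← Measure.prod_restrict] at hint
    exact hint.integral_prod_right
  rw [hone, key₂, key₁, hdouble]
  simp_rw [hinner, hfirst]
  rw [integral_sub hint₂ hint₃]
  ring

section Kernel

variable {α : Type*} [MeasurableSpace α] {τ : Measure α}

/-- Fubini for the kernel `1_{p ≤ ψ a}`. -/
lemma integral_integral_indicator_Ici [SFinite τ] {μ : Measure Pt} [IsFiniteMeasure μ] {ρ : Pt}
    (hμ : ∀ᵐ p ∂μ, ρ ≤ p) {ψ : α → Pt} (hψ : Measurable ψ) {g : Pt → ℂ}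
    (hg : Integrable (fun a => g (ψ a)) τ) :
    Integrable (fun p => ∫ a, (Ici p).indicator g (ψ a) ∂τ) μ ∧
    Integrable (fun a => μ.real (Icc ρ (ψ a)) • g (ψ a)) τ ∧
    ∫ p, ∫ a, (Ici p).indicator g (ψ a) ∂τ ∂μ = ∫ a, μ.real (Icc ρ (ψ a)) • g (ψ a) ∂τ := by
  have hset : MeasurableSet {q : Pt × α | q.1 ≤ ψ q.2} :=
    measurableSet_le measurable_fst (hψ.comp measurable_snd)
  have hF : Integrable (fun q : Pt × α => (Ici q.1).indicator g (ψ q.2)) (μ.prod τ) :=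
    (hg.comp_snd μ).indicator hset
  have hinner : ∀ a, ∫ p, (Ici p).indicator g (ψ a) ∂μ = μ.real (Icc ρ (ψ a)) • g (ψ a) := by
    intro a
    rw [← integral_indicator_const _ measurableSet_Icc]
    refine integral_congr_ae ?_
    filter_upwards [hμ] with p hp
    simp only [indicator, mem_Ici, mem_Icc, hp, true_and]
  refine ⟨hF.integral_prod_left, ?_, ?_⟩
  · simpa only [hinner] using hF.integral_prod_right
  · rw [integral_integral_swap hF]
    simp only [hinner]

lemma norm_integral_kernel_sub_le [SFinite τ] {μ ν : Measure Pt} [IsFiniteMeasure μ]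
    [IsFiniteMeasure ν] {ρ : Pt} (hμ : ∀ᵐ p ∂μ, ρ ≤ p) (hν : ∀ᵐ p ∂ν, ρ ≤ p) {ψ : α → Pt}
    (hψ : Measurable ψ) {g : Pt → ℂ} (hg : Integrable (fun a => g (ψ a)) τ) {D : ℝ}
    (hD : ∀ᵐ a ∂τ, |μ.real (Icc ρ (ψ a)) - ν.real (Icc ρ (ψ a))| ≤ D) :
    ‖(∫ p, ∫ a, (Ici p).indicator g (ψ a) ∂τ ∂μ) - ∫ p, ∫ a, (Ici p).indicator g (ψ a) ∂τ ∂ν‖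
      ≤ D * ∫ a, ‖g (ψ a)‖ ∂τ := by
  obtain ⟨-, hiμ, heμ⟩ := integral_integral_indicator_Ici hμ hψ hg
  obtain ⟨-, hiν, heν⟩ := integral_integral_indicator_Ici hν hψ hg
  rw [heμ, heν, ← integral_sub hiμ hiν, ← integral_const_mul]
  refine norm_integral_le_of_norm_le (hg.norm.const_mul D) ?_
  filter_upwards [hD] with a ha
  rw [← sub_smul, norm_smul]
  exact mul_le_mul_of_nonneg_right ha (norm_nonneg _)

/-- Averaging the translates of an integrable function. -/
lemma integral_integral_add {E : Type*} [NormedAddCommGroup E] [NormedSpace ℝ E]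
    [CompleteSpace E] [IsFiniteMeasure τ] {f : Pt → E} (hf : Integrable f) (hfm : StronglyMeasurable f)
    {φ : α → Pt} (hφ : Measurable φ) :
    Integrable (fun ρ => ∫ a, f (ρ + φ a) ∂τ) ∧
      ∫ ρ, ∫ a, f (ρ + φ a) ∂τ = τ.real univ • ∫ x, f x := by
  have hF : Integrable (fun q : Pt × α => f (q.1 + φ q.2)) ((volume : Measure Pt).prod τ) := by
    have hm : Measurable fun q : Pt × α => q.1 + φ q.2 := by fun_prop
    refine (integrable_prod_iff' (hfm.comp_measurable hm).aestronglyMeasurable).2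
      ⟨.of_forall fun a => hf.comp_add_right (φ a), ?_⟩
    exact (integrable_const (∫ x, ‖f x‖)).congr
      (.of_forall fun a => (integral_add_right_eq_self (fun x => ‖f x‖) (φ a)).symm)
  refine ⟨hF.integral_prod_left, ?_⟩
  rw [integral_integral_swap hF]
  simp_rw [integral_add_right_eq_self f]
  exact integral_const _

end Kernel

lemma volume_real_Icc_pt {ρ η : Pt} (hη : 0 ≤ η) :
    (volume : Measure Pt).real (Icc ρ (ρ + η)) = η.1 * η.2 := by
  have : Icc ρ (ρ + η) = Icc ρ.1 (ρ + η).1 ×ˢ Icc ρ.2 (ρ + η).2 := (Icc_prod_Icc _ _ _ _).symm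
  rw [this, Measure.volume_eq_prod, measureReal_prod_prod, Real.volume_real_Icc_of_le,
    Real.volume_real_Icc_of_le]
  · simp
  · simpa using hη.2
  · simpa using hη.1

instance : IsProbabilityMeasure ((volume : Measure ℝ).restrict (Icc (0 : ℝ) 1)) :=
  ⟨by simp⟩

instance (ρ : Pt) : IsProbabilityMeasure ((volume : Measure Pt).restrict (Icc ρ (ρ + 1))) :=
  ⟨by
    have := volume_real_Icc_pt (ρ := ρ) (η := 1) zero_le_one
    rw [Measure.restrict_apply_univ, ← ENNReal.toReal_eq_one_iff]
    simpa [Measure.real] using this⟩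

instance : IsProbabilityMeasure ((volume : Measure Pt).restrict (Icc (0 : Pt) 1)) := by
  simpa using (inferInstance :
    IsProbabilityMeasure ((volume : Measure Pt).restrict (Icc (0 : Pt) (0 + 1))))

/-- The part of the Hardy–Krause variation of `h` on `ρ + [0,1]²` that is carried by the right
edge, the upper edge and the interior. -/
def boxVariation (h : Pt → ℂ) (ρ : Pt) : ℝ :=
  (∫ u in Icc (0 : ℝ) 1, ‖d1 h (ρ + (u, 1))‖) + (∫ v in Icc (0 : ℝ) 1, ‖d2 h (ρ + (1, v))‖) +
    ∫ η in Icc (0 : Pt) 1, ‖d12 h (ρ + η)‖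

lemma integral_boxVariation {h : Pt → ℂ} (hsm : HasContMixedPartials h)
    (hint1 : Integrable (d1 h)) (hint2 : Integrable (d2 h)) (hint12 : Integrable (d12 h)) :
    Integrable (boxVariation h) ∧ ∫ ρ, boxVariation h ρ =
      (∫ x : Pt, ‖d1 h x‖) + (∫ x : Pt, ‖d2 h x‖) + (∫ x : Pt, ‖d12 h x‖) := by
  obtain ⟨-, -, -, -, hc1, hc2, hc12⟩ := hsm
  have h1 := integral_integral_add (τ := volume.restrict (Icc (0 : ℝ) 1)) hint1.norm
    hc1.norm.stronglyMeasurable (φ := fun u => (u, 1)) (by fun_prop)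
  have h2 := integral_integral_add (τ := volume.restrict (Icc (0 : ℝ) 1)) hint2.norm
    hc2.norm.stronglyMeasurable (φ := fun v => (1, v)) (by fun_prop)
  have h3 := integral_integral_add (τ := volume.restrict (Icc (0 : Pt) 1)) hint12.norm
    hc12.norm.stronglyMeasurable (φ := fun η => η) measurable_id
  refine ⟨(h1.1.add h2.1).add h3.1, ?_⟩
  refine (integral_add (h1.1.add h2.1) h3.1).trans ?_
  rw [h3.2, integral_add' h1.1 h2.1, h1.2, h2.2]
  simp only [probReal_univ, one_smul]

lemma integrable_unitInterval_of_continuous {g : ℝ → ℂ} (hg : Continuous g) :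
    Integrable g (volume.restrict (Icc (0 : ℝ) 1)) :=
  hg.continuousOn.integrableOn_compact isCompact_Icc

lemma integrable_unitSquare_of_continuous {g : Pt → ℂ} (hg : Continuous g) :
    Integrable g (volume.restrict (Icc (0 : Pt) 1)) :=
  hg.continuousOn.integrableOn_compact isCompact_Icc

/-- The maximum of `|h|` on `ρ + [0,1]²` is controlled by a corner value and the variation. -/
lemma norm_le_add_boxVariation {h : Pt → ℂ} (hsm : HasContMixedPartials h) {ρ p : Pt}
    (hp : p ∈ Icc ρ (ρ + 1)) : ‖h p‖ ≤ ‖h (ρ + 1)‖ + boxVariation h ρ := by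
  rw [hsm.eq_anchored hp]
  obtain ⟨-, -, -, -, hc1, hc2, hc12⟩ := hsm
  have h1 : ‖∫ u in Icc (0 : ℝ) 1, (Ici p).indicator (d1 h) (ρ + (u, 1))‖ ≤
      ∫ u in Icc (0 : ℝ) 1, ‖d1 h (ρ + (u, 1))‖ :=
    norm_integral_le_of_norm_le
      (integrable_unitInterval_of_continuous (g := fun u => d1 h (ρ + (u, 1))) (by fun_prop)).norm
      (.of_forall fun _ => norm_indicator_le_norm_self _ _)
  have h2 : ‖∫ v in Icc (0 : ℝ) 1, (Ici p).indicator (d2 h) (ρ + (1, v))‖ ≤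
      ∫ v in Icc (0 : ℝ) 1, ‖d2 h (ρ + (1, v))‖ :=
    norm_integral_le_of_norm_le
      (integrable_unitInterval_of_continuous (g := fun v => d2 h (ρ + (1, v))) (by fun_prop)).norm
      (.of_forall fun _ => norm_indicator_le_norm_self _ _)
  have h3 : ‖∫ η in Icc (0 : Pt) 1, (Ici p).indicator (d12 h) (ρ + η)‖ ≤
      ∫ η in Icc (0 : Pt) 1, ‖d12 h (ρ + η)‖ :=
    norm_integral_le_of_norm_le
      (integrable_unitSquare_of_continuous (g := fun η => d12 h (ρ + η)) (by fun_prop)).norm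
      (.of_forall fun _ => norm_indicator_le_norm_self _ _)
  unfold boxVariation
  refine (norm_add_le _ _).trans ?_
  have := (norm_sub_le (h (ρ + 1) - ∫ u in Icc (0 : ℝ) 1, (Ici p).indicator (d1 h) (ρ + (u, 1)))
    (∫ v in Icc (0 : ℝ) 1, (Ici p).indicator (d2 h) (ρ + (1, v)))).trans
    (add_le_add_left (norm_sub_le _ _) _)
  linarith

/-- Koksma–Hlawka inequality for two probability measures on `ρ + [0,1]²`. -/
lemma norm_integral_sub_integral_le {h : Pt → ℂ} (hsm : HasContMixedPartials h) {ρ : Pt}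
    {μ ν : Measure Pt} [IsProbabilityMeasure μ] [IsProbabilityMeasure ν]
    (hμ : ∀ᵐ p ∂μ, p ∈ Icc ρ (ρ + 1)) (hν : ∀ᵐ p ∂ν, p ∈ Icc ρ (ρ + 1)) {D : ℝ}
    (hD : ∀ η ∈ Icc (0 : Pt) 1, |μ.real (Icc ρ (ρ + η)) - ν.real (Icc ρ (ρ + η))| ≤ D) :
    ‖(∫ p, h p ∂μ) - ∫ p, h p ∂ν‖ ≤ D * boxVariation h ρ := by
  have hanch := fun p (hp : p ∈ Icc ρ (ρ + 1)) => hsm.eq_anchored hp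
  obtain ⟨-, -, -, -, hc1, hc2, hc12⟩ := hsm
  have hg1 := integrable_unitInterval_of_continuous (g := fun u => d1 h (ρ + (u, 1))) (by fun_prop)
  have hg2 := integrable_unitInterval_of_continuous (g := fun v => d2 h (ρ + (1, v))) (by fun_prop)
  have hg3 := integrable_unitSquare_of_continuous (g := fun η => d12 h (ρ + η)) (by fun_prop)
  have hm1 : Measurable fun u : ℝ => ρ + (u, 1) := by fun_prop
  have hm2 : Measurable fun v : ℝ => ρ + (1, v) := by fun_prop
  have hm3 : Measurable fun η : Pt => ρ + η := by fun_prop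
  have expand : ∀ (κ : Measure Pt) [IsProbabilityMeasure κ], (∀ᵐ p ∂κ, p ∈ Icc ρ (ρ + 1)) →
      ∫ p, h p ∂κ = h (ρ + 1)
        - (∫ p, (∫ u in Icc (0 : ℝ) 1, (Ici p).indicator (d1 h) (ρ + (u, 1))) ∂κ)
        - (∫ p, (∫ v in Icc (0 : ℝ) 1, (Ici p).indicator (d2 h) (ρ + (1, v))) ∂κ)
        + ∫ p, (∫ η in Icc (0 : Pt) 1, (Ici p).indicator (d12 h) (ρ + η)) ∂κ := by
    intro κ _ hκ
    have hκ' : ∀ᵐ p ∂κ, ρ ≤ p := hκ.mono fun p hp => hp.1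
    have i1 := (integral_integral_indicator_Ici hκ' hm1 hg1).1
    have i2 := (integral_integral_indicator_Ici hκ' hm2 hg2).1
    have i3 := (integral_integral_indicator_Ici hκ' hm3 hg3).1
    have i0 : Integrable (fun _ : Pt => h (ρ + 1)) κ := integrable_const _
    refine (integral_congr_ae (hκ.mono hanch)).trans
      ((integral_add ((i0.sub i1).sub i2) i3).trans ?_)
    rw [integral_sub' (i0.sub i1) i2, integral_sub' i0 i1, integral_const, probReal_univ, one_smul]
  have hμ' : ∀ᵐ p ∂μ, ρ ≤ p := hμ.mono fun p hp => hp.1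
  have hν' : ∀ᵐ p ∂ν, ρ ≤ p := hν.mono fun p hp => hp.1
  have b1 := norm_integral_kernel_sub_le (D := D) hμ' hν' hm1 hg1 <| by
    filter_upwards [ae_restrict_mem measurableSet_Icc] with u hu
    exact hD _ ⟨⟨hu.1, zero_le_one⟩, ⟨hu.2, le_rfl⟩⟩
  have b2 := norm_integral_kernel_sub_le (D := D) hμ' hν' hm2 hg2 <| by
    filter_upwards [ae_restrict_mem measurableSet_Icc] with v hv
    exact hD _ ⟨⟨zero_le_one, hv.1⟩, ⟨le_rfl, hv.2⟩⟩
  have b3 := norm_integral_kernel_sub_le (D := D) hμ' hν' hm3 hg3 <| by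
    filter_upwards [ae_restrict_mem measurableSet_Icc] with η hη
    exact hD _ hη
  rw [expand μ hμ, expand ν hν]
  unfold boxVariation
  generalize (∫ p, (∫ u in Icc (0 : ℝ) 1, (Ici p).indicator (d1 h) (ρ + (u, 1))) ∂μ) = A₁ at *
  generalize (∫ p, (∫ u in Icc (0 : ℝ) 1, (Ici p).indicator (d1 h) (ρ + (u, 1))) ∂ν) = B₁ at *
  generalize (∫ p, (∫ v in Icc (0 : ℝ) 1, (Ici p).indicator (d2 h) (ρ + (1, v))) ∂μ) = A₂ at *
  generalize (∫ p, (∫ v in Icc (0 : ℝ) 1, (Ici p).indicator (d2 h) (ρ + (1, v))) ∂ν) = B₂ at *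
  generalize (∫ p, (∫ η in Icc (0 : Pt) 1, (Ici p).indicator (d12 h) (ρ + η)) ∂μ) = A₃ at *
  generalize (∫ p, (∫ η in Icc (0 : Pt) 1, (Ici p).indicator (d12 h) (ρ + η)) ∂ν) = B₃ at *
  calc ‖h (ρ + 1) - A₁ - A₂ + A₃ - (h (ρ + 1) - B₁ - B₂ + B₃)‖
      = ‖(A₃ - B₃) - ((A₁ - B₁) + (A₂ - B₂))‖ := by congr 1; ring
    _ ≤ ‖A₃ - B₃‖ + (‖A₁ - B₁‖ + ‖A₂ - B₂‖) :=
        (norm_sub_le _ _).trans (add_le_add_right (norm_add_le _ _) _)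
    _ ≤ _ := by linarith

lemma uniformOn_real_eq_ncard_div {s : Set Pt} (hs : s.Finite) (t : Set Pt) :
    (ProbabilityTheory.uniformOn s).real t = ((s ∩ t).ncard : ℝ) / s.ncard := by
  rw [Measure.real, ProbabilityTheory.uniformOn, ProbabilityTheory.cond_apply hs.measurableSet,
    Measure.count_apply hs.measurableSet, Measure.count_apply (hs.inter_of_left t).measurableSet,
    ← hs.cast_ncard_eq, ← (hs.inter_of_left t).cast_ncard_eq]
  simp [div_eq_inv_mul]

lemma integral_uniformOn {s : Set Pt} (hs : s.Finite) (f : Pt → ℂ) :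
    ∫ p, f p ∂(ProbabilityTheory.uniformOn s) = (s.ncard : ℂ)⁻¹ * ∑' p : s, f p := by
  lift s to Finset Pt using hs
  have : IsFiniteMeasure ((Measure.count : Measure Pt).restrict s) := ⟨by simp⟩
  have hf : IntegrableOn f s Measure.count := by
    simpa [IntegrableOn, Measure.restrict_restrict s.measurableSet] using
      IntegrableOn.finset (μ := Measure.count.restrict s) (f := f) (s := s)
  rw [ProbabilityTheory.uniformOn, ProbabilityTheory.cond, integral_smul_measure,
    setIntegral_finset _ hf, Finset.tsum_subtype']
  simp [Measure.real]

lemma abs_ncard_div_sub_le_one {Λ : Set Pt} (hfin : ∀ ρ : Pt, (Λ ∩ Icc ρ (ρ + 1)).Finite)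
    (ρ : Pt) (η : Icc (0 : Pt) 1) :
    |((Λ ∩ Icc ρ (ρ + (η : Pt))).ncard : ℝ) / (nPts Λ ρ : ℝ) - (η : Pt).1 * (η : Pt).2| ≤ 1 := by
  obtain ⟨η, ⟨h01, h02⟩, ⟨h11, h12⟩⟩ := η
  have hle : ((Λ ∩ Icc ρ (ρ + η)).ncard : ℝ) ≤ nPts Λ ρ := by
    refine Nat.cast_le.2 (ncard_le_ncard ?_ (hfin ρ))
    exact inter_subset_inter_right _
      (Icc_subset_Icc_right (add_le_add_right (Prod.mk_le_mk.2 ⟨h11, h12⟩) ρ))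
  have h1 := div_le_one_of_le₀ hle (Nat.cast_nonneg _)
  have h0 : 0 ≤ ((Λ ∩ Icc ρ (ρ + η)).ncard : ℝ) / nPts Λ ρ := by positivity
  have h3 : η.1 * η.2 ≤ 1 := mul_le_one₀ h11 h02 h12
  have h2 : 0 ≤ η.1 * η.2 := mul_nonneg h01 h02
  exact abs_le.2 ⟨by linarith, by linarith⟩

lemma abs_ncard_div_sub_le_starDiscShift {Λ : Set Pt} (hfin : ∀ ρ : Pt, (Λ ∩ Icc ρ (ρ + 1)).Finite)
    (ρ : Pt) {η : Pt} (hη : η ∈ Icc (0 : Pt) 1) :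
    |((Λ ∩ Icc ρ (ρ + η)).ncard : ℝ) / (nPts Λ ρ : ℝ) - η.1 * η.2| ≤ starDiscShift Λ := by
  have hbdd : BddAbove (range (starDiscAt Λ)) := by
    refine ⟨1, ?_⟩
    rintro _ ⟨ρ, rfl⟩
    exact Real.iSup_le (abs_ncard_div_sub_le_one hfin ρ) zero_le_one
  refine le_trans ?_ (le_ciSup hbdd ρ)
  refine le_ciSup (f := fun η : Icc (0 : Pt) 1 =>
    |((Λ ∩ Icc ρ (ρ + (η : Pt))).ncard : ℝ) / (nPts Λ ρ : ℝ) - (η : Pt).1 * (η : Pt).2|) ?_ ⟨η, hη⟩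
  refine ⟨1, ?_⟩
  rintro _ ⟨η, rfl⟩
  exact abs_ncard_div_sub_le_one hfin ρ η

/-- Koksma–Hlawka inequality on the translated unit square. -/
lemma norm_localErr_le {Λ : Set Pt} (hfin : ∀ ρ : Pt, (Λ ∩ Icc ρ (ρ + 1)).Finite)
    {h : Pt → ℂ} (hsm : HasContMixedPartials h) {ρ : Pt}
    (hone : 1 ≤ nPts Λ ρ) : ‖localErr Λ h ρ‖ ≤ starDiscShift Λ * boxVariation h ρ := by
  have hne : (Λ ∩ Icc ρ (ρ + 1)).Nonempty := nonempty_of_ncard_ne_zero (by unfold nPts at hone; lia)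
  have := ProbabilityTheory.isProbabilityMeasure_uniformOn (hfin ρ) hne
  have hmem : ∀ᵐ p ∂ProbabilityTheory.uniformOn (Λ ∩ Icc ρ (ρ + 1)), p ∈ Icc ρ (ρ + 1) :=
    (ProbabilityTheory.ae_cond_mem (hfin ρ).measurableSet).mono fun p hp => hp.2
  rw [localErr, nPts, ← integral_uniformOn (hfin ρ)]
  refine norm_integral_sub_integral_le hsm (ae_restrict_mem measurableSet_Icc) hmem
    fun η hη => ?_
  have hsub : Icc ρ (ρ + η) ⊆ Icc ρ (ρ + 1) := Icc_subset_Icc_right (add_le_add_right hη.2 ρ)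
  rw [uniformOn_real_eq_ncard_div (hfin ρ), inter_assoc, inter_eq_self_of_subset_right hsub,
    measureReal_restrict_apply measurableSet_Icc, inter_eq_self_of_subset_left hsub,
    volume_real_Icc_pt hη.1, abs_sub_comm]
  exact abs_ncard_div_sub_le_starDiscShift hfin ρ hη

lemma tsum_subtype_indicator {α M : Type*} [AddCommMonoid M] [TopologicalSpace M] (s t : Set α)
    (f : α → M) : ∑' p : s, t.indicator f p = ∑' p : ↥(s ∩ t), f p := by
  rw [tsum_subtype s (t.indicator f), indicator_indicator, ← tsum_subtype]

lemma measurableSet_mem_Icc_add_one (p : Pt) : MeasurableSet {ρ : Pt | p ∈ Icc ρ (ρ + 1)} :=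
  (measurableSet_le measurable_id measurable_const).inter
    (measurableSet_le measurable_const (measurable_id.add_const 1))

lemma measurable_nPts {Λ : Set Pt} (hcount : Λ.Countable) :
    Measurable fun ρ => (nPts Λ ρ : ℝ) := by
  have := hcount.to_subtype
  have heq : ∀ ρ, (nPts Λ ρ : ℝ) = ∑' p : Λ, {ρ : Pt | (p : Pt) ∈ Icc ρ (ρ + 1)}.indicator 1 ρ := by
    intro ρ
    have := tsum_subtype_indicator Λ (Icc ρ (ρ + 1)) (1 : Pt → ℝ)
    simp only [Pi.one_apply, tsum_const, Nat.card_coe_set_eq, nsmul_eq_mul, mul_one] at this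
    exact this.symm
  simp_rw [heq]
  exact Measurable.tsum fun p => measurable_one.indicator (measurableSet_mem_Icc_add_one p)

lemma quadErr_eq_integral_localErr {Λ : Set Pt} (hcount : Λ.Countable)
    (hfin : ∀ ρ : Pt, (Λ ∩ Icc ρ (ρ + 1)).Finite) (hone : ∀ ρ : Pt, 1 ≤ nPts Λ ρ)
    {h : Pt → ℂ} (hint : Integrable h) (hc : Continuous h) {B : Pt → ℝ} (hB : Integrable B)
    (hle : ∀ ρ, ∀ p ∈ Icc ρ (ρ + 1), ‖h p‖ ≤ B ρ) :
    quadErr Λ h = ∫ ρ, localErr Λ h ρ := by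
  have := hcount.to_subtype
  set f : Λ → Pt → ℂ := fun p ρ =>
    (((Icc ρ (ρ + 1)).indicator (fun _ => (1 : ℝ)) (p : Pt) / (nPts Λ ρ : ℝ) : ℝ) : ℂ) * h p with hf
  have hf_eq : ∀ ρ (p : Λ), f p ρ =
      (Icc ρ (ρ + 1)).indicator (fun q => (nPts Λ ρ : ℂ)⁻¹ * h q) p := by
    intro ρ p
    simp only [hf, indicator]
    split_ifs <;> simp
  have hf_meas : ∀ p, Measurable (f p) := fun p =>
    (Complex.measurable_ofReal.comp ((measurable_const.indicator
      (measurableSet_mem_Icc_add_one p)).div (measurable_nPts hcount))).mul_const _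
  have hf_sum : ∀ ρ, (nPts Λ ρ : ℂ)⁻¹ * ∑' p : ↥(Λ ∩ Icc ρ (ρ + 1)), h p = ∑' p, f p ρ := by
    intro ρ
    simp_rw [hf_eq]
    rw [tsum_subtype_indicator Λ _ fun q => (nPts Λ ρ : ℂ)⁻¹ * h q, tsum_mul_left]
  have hf_enorm : ∀ ρ, ∑' p, ‖f p ρ‖ₑ ≤ ENNReal.ofReal (B ρ) := by
    intro ρ
    have hN : (0 : ℝ) < nPts Λ ρ := Nat.cast_pos.2 (hone ρ)
    have hcard : ((Λ ∩ Icc ρ (ρ + 1)).encard : ENNReal) = ENNReal.ofReal (nPts Λ ρ) := by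
      rw [← (hfin ρ).cast_ncard_eq, ENNReal.ofReal_natCast]
      rfl
    calc ∑' p, ‖f p ρ‖ₑ
        = ∑' p : ↥(Λ ∩ Icc ρ (ρ + 1)), ‖(nPts Λ ρ : ℂ)⁻¹ * h p‖ₑ := by
          simp_rw [hf_eq, enorm_indicator_eq_indicator_enorm]
          exact tsum_subtype_indicator Λ _ fun q => ‖(nPts Λ ρ : ℂ)⁻¹ * h q‖ₑ
      _ ≤ ∑' _ : ↥(Λ ∩ Icc ρ (ρ + 1)), ENNReal.ofReal ((nPts Λ ρ : ℝ)⁻¹ * B ρ) := by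
          refine ENNReal.tsum_le_tsum fun p => ?_
          rw [← ofReal_norm, norm_mul, norm_inv, Complex.norm_natCast]
          exact ENNReal.ofReal_le_ofReal
            (mul_le_mul_of_nonneg_left (hle ρ p p.2.2) (inv_nonneg.2 hN.le))
      _ = ENNReal.ofReal (B ρ) := by
          rw [ENNReal.tsum_set_const, hcard, ← ENNReal.ofReal_mul hN.le,
            mul_inv_cancel_left₀ hN.ne']
  have hfinite : ∫⁻ ρ, ∑' p, ‖f p ρ‖ₑ < ⊤ :=
    (lintegral_mono hf_enorm).trans_lt
      ((lintegral_mono fun _ => Real.ofReal_le_enorm _).trans_lt hB.hasFiniteIntegral)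
  have hsum_int : Integrable fun ρ => ∑' p, f p ρ :=
    ⟨(Measurable.tsum hf_meas).aestronglyMeasurable,
      (lintegral_mono fun _ => enorm_tsum_le_tsum_enorm).trans_lt hfinite⟩
  have hbox : ∀ ρ, ∫ η in Icc ρ (ρ + 1), h η = ∫ η in Icc (0 : Pt) 1, h (ρ + η) := by
    intro ρ
    rw [← (measurePreserving_add_left volume ρ).setIntegral_preimage_emb
      (measurableEmbedding_addLeft ρ)]
    simp
  have havg := integral_integral_add (τ := volume.restrict (Icc (0 : Pt) 1)) hint
    hc.stronglyMeasurable (φ := fun η => η) measurable_id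
  unfold localErr quadErr
  simp_rw [hbox, hf_sum]
  rw [integral_sub havg.1 hsum_int, havg.2, probReal_univ, one_smul,
    integral_tsum (fun p => (hf_meas p).aestronglyMeasurable) ?_]
  · congr 2 with p
    rw [hf, integral_mul_const, integral_complex_ofReal]
    rfl
  · rw [← lintegral_tsum fun p => (hf_meas p).enorm.aemeasurable]
    exact hfinite.ne

/-- Global Koksma–Hlawka inequality on `ℝ²`. -/
theorem quadErr_le (Λ : Set Pt) (hcount : Λ.Countable)
    (hfin : ∀ ρ : Pt, (Λ ∩ Icc ρ (ρ + 1)).Finite)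
    (hone : ∀ ρ : Pt, 1 ≤ nPts Λ ρ)
    (h : Pt → ℂ) (hint : Integrable h) (hsm : HasContMixedPartials h)
    (hint1 : Integrable (d1 h)) (hint2 : Integrable (d2 h))
    (hint12 : Integrable (d12 h)) :
    ‖quadErr Λ h‖ ≤ (∫ ρ : Pt, ‖localErr Λ h ρ‖) ∧
      (∫ ρ : Pt, ‖localErr Λ h ρ‖) ≤
        starDiscShift Λ *
          ((∫ x : Pt, ‖d1 h x‖) + (∫ x : Pt, ‖d2 h x‖) + (∫ x : Pt, ‖d12 h x‖)) := by
  obtain ⟨hV, hVint⟩ := integral_boxVariation hsm hint1 hint2 hint12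
  constructor
  · rw [quadErr_eq_integral_localErr hcount hfin hone hint hsm.1
      ((hint.comp_add_right 1).norm.add hV) fun ρ p hp => norm_le_add_boxVariation hsm hp]
    exact norm_integral_le_integral_norm _
  · rw [← hVint, ← integral_const_mul]
    exact integral_mono_of_nonneg (.of_forall fun _ => norm_nonneg _) (hV.const_mul _)
      (.of_forall fun ρ => norm_localErr_le hfin hsm (hone ρ))
end
end

section
/- Let Γ ⊂ ℝ² be an admissible full-rank lattice, i.e. inf_{(γ₁,γ₂)∈Γ\{0}} |γ₁γ₂| > 0. Then there exists a constant C = C(Γ) such that D*_shift(aΓ_τ) ≤ C a² ln(2 + a^{−1}) for all a ∈ (0,1) and all τ > 0, where Γ_τ = { (τγ₁, τ^{−1}γ₂) : (γ₁,γ₂) ∈ Γ }. -/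
open MeasureTheory Set Real

noncomputable section

/-- The full-rank lattice `M ℤ² ⊂ ℝ²` generated by an invertible matrix `M`. -/
def latticeOf (M : Matrix (Fin 2) (Fin 2) ℝ) : Set Pt :=
  {p : Pt | ∃ m n : ℤ, p = (M 0 0 * m + M 0 1 * n, M 1 0 * m + M 1 1 * n)}

/-- A lattice `Γ ⊂ ℝ²` is admissible if `inf_{γ ∈ Γ \ {0}} |γ₁γ₂| > 0`. -/
def IsAdmissible (Γ : Set Pt) : Prop :=
  ∃ c > 0, ∀ γ ∈ Γ, γ ≠ (0 : Pt) → c ≤ |γ.1 * γ.2|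

/-- The dilated set `Λ_τ = {(τλ₁, τ⁻¹λ₂) : λ ∈ Λ}`. -/
def dilate (τ : ℝ) (Λ : Set Pt) : Set Pt := (fun p : Pt => (τ * p.1, τ⁻¹ * p.2)) '' Λ

/-- The scaled set `aΛ`. -/
def scaleSet (a : ℝ) (Λ : Set Pt) : Set Pt := (fun p : Pt => (a * p.1, a * p.2)) '' Λ

/-- The point of `latticeOf M` with integer coordinates `z`. -/
def latPt (M : Matrix (Fin 2) (Fin 2) ℝ) (z : ℤ × ℤ) : Pt :=
  (M 0 0 * z.1 + M 0 1 * z.2, M 1 0 * z.1 + M 1 1 * z.2)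

lemma latticeOf_eq_range (M : Matrix (Fin 2) (Fin 2) ℝ) : latticeOf M = range (latPt M) := by
  ext p
  simp [latticeOf, latPt, eq_comm]

lemma latPt_injective {M : Matrix (Fin 2) (Fin 2) ℝ} (hM : M.det ≠ 0) :
    Function.Injective (latPt M) := by
  rintro ⟨a, b⟩ ⟨a', b'⟩ h
  simp only [latPt, Prod.mk.injEq] at h
  obtain ⟨h1, h2⟩ := h
  rw [Matrix.det_fin_two] at hM
  have e1 : (a : ℝ) = a' := by
    apply mul_left_cancel₀ hM
    linear_combination M 1 1 * h1 - M 0 1 * h2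
  have e2 : (b : ℝ) = b' := by
    apply mul_left_cancel₀ hM
    linear_combination M 0 0 * h2 - M 1 0 * h1
  exact Prod.ext (by exact_mod_cast e1) (by exact_mod_cast e2)

lemma exists_ne_zero_latPt_le {M : Matrix (Fin 2) (Fin 2) ℝ} (hM : 0 < M.det) {t : ℝ}
    (ht : 0 < t) :
    ∃ z : ℤ × ℤ, z ≠ 0 ∧ |(latPt M z).1| ≤ 2 * M.det / t ∧ |(latPt M z).2| ≤ t := by
  set b := Pi.basisFun ℝ (Fin 2)
  set r : Fin 2 → ℝ := ![2 * M.det / t, t]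
  have hdet : LinearMap.det (Matrix.toLin' M) = M.det := LinearMap.det_toLin' M
  have hvol : volume (Matrix.toLin' M ⁻¹' Icc (-r) r) = ENNReal.ofReal 8 := by
    rw [Measure.addHaar_preimage_linearMap _ (by rw [hdet]; exact hM.ne'), Real.volume_Icc_pi,
      hdet, Fin.prod_univ_two, ← ENNReal.ofReal_mul (by simp [r]; positivity),
      ← ENNReal.ofReal_mul (abs_nonneg _), abs_of_pos (inv_pos.2 hM)]
    congr 1
    simp only [r, Pi.neg_apply, Matrix.cons_val_zero, Matrix.cons_val_one]
    field_simp
    norm_num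
  have : Countable (Submodule.span ℤ (range b)).toAddSubgroup :=
    inferInstanceAs (Countable (Submodule.span ℤ (range b)))
  have key := exists_ne_zero_mem_lattice_of_measure_mul_two_pow_lt_measure
    (s := Matrix.toLin' M ⁻¹' Icc (-r) r) (ZSpan.isAddFundamentalDomain' b volume)
    (fun x hx => by
      simp only [mem_preimage, mem_Icc, map_neg] at hx ⊢
      exact ⟨neg_le_neg hx.2, neg_le.1 hx.1⟩)
    ((convex_Icc _ _).linear_preimage _)
    (by
      rw [hvol, ZSpan.volume_fundamentalDomain]
      have : (Matrix.of ⇑b).det = 1 := by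
        rw [show Matrix.of ⇑b = 1 from by
          ext i j; simp [b, Matrix.one_apply, Pi.single_apply, eq_comm], Matrix.det_one]
      rw [this]
      simp only [abs_one, ENNReal.ofReal_one, one_mul, Module.finrank_fin_fun]
      rw [show (2 : ENNReal) ^ 2 = ENNReal.ofReal 4 by norm_num]
      exact (ENNReal.ofReal_lt_ofReal_iff (by norm_num)).2 (by norm_num))
  obtain ⟨⟨v, hv⟩, hv0, hvs⟩ := key
  have hv' := (Module.Basis.mem_span_iff_repr_mem ℤ b v).1 hv
  obtain ⟨m, hm⟩ := hv' 0
  obtain ⟨n, hn⟩ := hv' 1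
  simp only [b, Pi.basisFun_repr, algebraMap_int_eq, eq_intCast] at hm hn
  simp only [mem_preimage, mem_Icc, Pi.le_def, Fin.forall_fin_two, Matrix.toLin'_apply,
    Matrix.mulVec, dotProduct, Fin.sum_univ_two, r, Pi.neg_apply, Matrix.cons_val_zero,
    Matrix.cons_val_one, ← hm, ← hn] at hvs
  refine ⟨(m, n), ?_, abs_le.2 ⟨hvs.1.1, hvs.2.1⟩, abs_le.2 ⟨hvs.1.2, hvs.2.2⟩⟩
  intro h0
  simp only [Prod.mk_eq_zero] at h0
  apply hv0
  ext i
  fin_cases i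
  · simp [← hm, h0.1]
  · simp [← hn, h0.2]

lemma exists_isCoprime_latPt_le {M : Matrix (Fin 2) (Fin 2) ℝ} (hM : 0 < M.det) {t : ℝ}
    (ht : 0 < t) :
    ∃ z : ℤ × ℤ, IsCoprime z.1 z.2 ∧ |(latPt M z).1| ≤ 2 * M.det / t ∧
      0 ≤ (latPt M z).2 ∧ (latPt M z).2 ≤ t := by
  obtain ⟨⟨m, n⟩, h0, h1, h2⟩ := exists_ne_zero_latPt_le hM ht
  have hg : 0 < Int.gcd m n := by
    rw [Int.gcd_pos_iff]
    by_contra! h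
    exact h0 (Prod.ext h.1 h.2)
  obtain ⟨m', n', hc, hm, hn⟩ := Int.exists_gcd_one hg
  rw [← Int.isCoprime_iff_gcd_eq_one] at hc
  set g := Int.gcd m n
  have hg1 : (1 : ℝ) ≤ g := by exact_mod_cast hg
  have shrink : ∀ u v B : ℝ, |u * m + v * n| ≤ B → |u * m' + v * n'| ≤ B := by
    intro u v B h
    have : u * m + v * n = (u * m' + v * n') * g := by
      rw [hm, hn]; push_cast; ring
    rw [this, abs_mul, abs_of_pos (by linarith : (0 : ℝ) < g)] at h
    nlinarith [abs_nonneg (u * m' + v * n')]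
  have h1' := shrink _ _ _ h1
  have h2' := shrink _ _ _ h2
  rcases le_total 0 (M 1 0 * (m' : ℝ) + M 1 1 * n') with h | h
  · exact ⟨(m', n'), hc, h1', h, (abs_le.1 h2').2⟩
  · refine ⟨(-m', -n'), hc.neg_neg, ?_, ?_, ?_⟩ <;> simp only [latPt] <;> push_cast
    · rw [← abs_neg]; convert h1' using 2; ring
    · linarith
    · linarith [(abs_le.1 h2').1]

lemma ncard_Icc_ceil_floor_le {u v : ℝ} (h : 0 ≤ v - u + 1) :
    ((Icc ⌈u⌉ ⌊v⌋).ncard : ℝ) ≤ v - u + 1 := by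
  rw [← Finset.coe_Icc, Set.ncard_coe_finset, Int.card_Icc]
  have : (((⌊v⌋ + 1 - ⌈u⌉).toNat : ℤ) : ℝ) ≤ v - u + 1 := by
    rw [Int.toNat_eq_max]
    push_cast
    exact max_le (by linarith [Int.floor_le v, Int.le_ceil u]) h
  exact_mod_cast this

lemma le_ncard_Icc_ceil_floor (u v : ℝ) : v - u - 1 ≤ ((Icc ⌈u⌉ ⌊v⌋).ncard : ℝ) := by
  rw [← Finset.coe_Icc, Set.ncard_coe_finset, Int.card_Icc]
  have : v - u - 1 ≤ (((⌊v⌋ + 1 - ⌈u⌉).toNat : ℤ) : ℝ) := by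
    rw [Int.toNat_eq_max]
    push_cast
    exact le_max_of_le_left (by linarith [Int.lt_floor_add_one v, Int.ceil_lt_add_one u])
  exact_mod_cast this

/-- A strip whose height `h` is the second coordinate of a primitive lattice vector contains
exactly one point of each lattice line parallel to that vector. -/
lemma abs_ncard_strip_sub_le {M : Matrix (Fin 2) (Fin 2) ℝ} (hM : 0 < M.det) {w : ℤ × ℤ}
    (hw : IsCoprime w.1 w.2) (hh : 0 < (latPt M w).2) (x y : ℝ) {s : ℝ} (hs : 0 ≤ s) :
    (latPt M ⁻¹' (Icc x (x + s) ×ˢ Ico y (y + (latPt M w).2))).Finite ∧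
      |((latPt M ⁻¹' (Icc x (x + s) ×ˢ Ico y (y + (latPt M w).2))).ncard : ℝ)
        - s * (latPt M w).2 / M.det| ≤ 2 * (|(latPt M w).1| * (latPt M w).2) / M.det + 1 := by
  obtain ⟨p, q⟩ := w
  simp only at hw
  set w1 := (latPt M (p, q)).1 with hw1
  set h := (latPt M (p, q)).2 with hh2
  set D := M.det with hD
  set S := latPt M ⁻¹' (Icc x (x + s) ×ˢ Ico y (y + h)) with hS
  set f : ℤ × ℤ → ℤ := fun z => z.1 * q - z.2 * p with hf
  have hcram : ∀ z, D * f z = (latPt M z).1 * h - (latPt M z).2 * w1 := by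
    intro z
    simp only [hD, hf, hw1, hh2, latPt, Matrix.det_fin_two]
    push_cast
    ring
  have hadd : ∀ (z : ℤ × ℤ) (l : ℤ),
      (latPt M (z.1 + l * p, z.2 + l * q)).2 = (latPt M z).2 + l * h := by
    intro z l
    simp only [hh2, latPt]
    push_cast
    ring
  have hinj : InjOn f S := by
    intro z hz z' hz' e
    simp only [hf] at e
    have e' : (z.1 - z'.1) * q = (z.2 - z'.2) * p := by linear_combination e
    obtain ⟨u, v, huv⟩ := hw
    obtain ⟨l, hl⟩ : ∃ l, l = u * (z.1 - z'.1) + v * (z.2 - z'.2) := ⟨_, rfl⟩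
    have hl1 : z.1 - z'.1 = l * p := by
      rw [hl]; linear_combination -(z.1 - z'.1) * huv + v * e'
    have hl2 : z.2 - z'.2 = l * q := by
      rw [hl]; linear_combination -(z.2 - z'.2) * huv - u * e'
    have hz2 : z = (z'.1 + l * p, z'.2 + l * q) :=
      Prod.ext (by simp only; linear_combination hl1) (by simp only; linear_combination hl2)
    have := hadd z' l
    rw [← hz2] at this
    have a1 := hz.2
    have a2 := hz'.2
    simp only [mem_Ico] at a1 a2
    have b1 : (l : ℝ) < 1 := by
      by_contra! hc
      nlinarith
    have b2 : (-1 : ℝ) < l := by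
      by_contra! hc
      nlinarith
    have c1 : l < 1 := by exact_mod_cast b1
    have c2 : -1 < l := by exact_mod_cast b2
    have : l = 0 := by omega
    rw [hz2, this]
    simp
  have hmul : ∀ r : ℝ, 0 ≤ r → r ≤ h → |r * w1| ≤ |w1| * h := by
    intro r h0 hr
    rw [abs_mul, abs_of_nonneg h0, mul_comm]
    exact mul_le_mul_of_nonneg_left hr (abs_nonneg _)
  have hupper : f '' S ⊆ Icc ⌈(x * h - y * w1 - |w1| * h) / D⌉
      ⌊(x * h + s * h - y * w1 + |w1| * h) / D⌋ := by
    rintro _ ⟨z, ⟨⟨hz1, hz2⟩, hz3, hz4⟩, rfl⟩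
    have hr := abs_le.1 (hmul ((latPt M z).2 - y) (by linarith) (by linarith))
    have := hcram z
    rw [mem_Icc, Int.ceil_le, Int.le_floor, div_le_iff₀ hM, le_div_iff₀ hM]
    constructor <;> nlinarith
  have hlower : Icc ⌈(x * h - y * w1 + |w1| * h) / D⌉
      ⌊(x * h + s * h - y * w1 - |w1| * h) / D⌋ ⊆ f '' S := by
    intro k hk
    rw [mem_Icc, Int.ceil_le, Int.le_floor, div_le_iff₀ hM, le_div_iff₀ hM] at hk
    obtain ⟨u, v, huv⟩ := hw
    obtain ⟨l, hl, -⟩ := existsUnique_add_zsmul_mem_Ico hh (latPt M (k * v, -(k * u))).2 y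
    simp only [zsmul_eq_mul] at hl
    rw [← hadd] at hl
    set z : ℤ × ℤ := (k * v + l * p, -(k * u) + l * q)
    have hfz : f z = k := by
      simp only [hf, z]
      linear_combination k * huv
    refine ⟨z, ⟨?_, hl⟩, hfz⟩
    have hr := abs_le.1 (hmul ((latPt M z).2 - y) (by linarith [hl.1]) (by linarith [hl.2]))
    have := hcram z
    rw [hfz] at this
    constructor
    · refine le_of_mul_le_mul_right ?_ hh
      linarith
    · refine le_of_mul_le_mul_right ?_ hh
      linarith
  have hfin : S.Finite := Finite.of_finite_image ((finite_Icc _ _).subset hupper) hinj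
  refine ⟨hfin, ?_⟩
  rw [← hinj.ncard_image]
  have hn : 0 ≤ |w1| * h := mul_nonneg (abs_nonneg _) hh.le
  have c1 : ((f '' S).ncard : ℝ) ≤ _ := (Nat.cast_le.2 (ncard_le_ncard hupper (finite_Icc _ _))).trans
    (ncard_Icc_ceil_floor_le (by
      rw [← sub_div]
      have : 0 ≤ s * h := mul_nonneg hs hh.le
      have : 0 ≤ (x * h + s * h - y * w1 + |w1| * h - (x * h - y * w1 - |w1| * h)) / D :=
        div_nonneg (by linarith) hM.le
      linarith))
  have c2 : _ ≤ ((f '' S).ncard : ℝ) := (le_ncard_Icc_ceil_floor _ _).trans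
    (Nat.cast_le.2 (ncard_le_ncard hlower (hfin.image f)))
  rw [← sub_div] at c1 c2
  have d1 : (x * h + s * h - y * w1 + |w1| * h - (x * h - y * w1 - |w1| * h)) / D
      = s * h / D + 2 * (|w1| * h) / D := by ring
  have d2 : (x * h + s * h - y * w1 - |w1| * h - (x * h - y * w1 + |w1| * h)) / D
      = s * h / D - 2 * (|w1| * h) / D := by ring
  rw [d1] at c1
  rw [d2] at c2
  rw [abs_le]
  constructor <;> linarith

/-- Two lattice points in a box of area less than the admissibility constant coincide. -/
lemma subsingleton_preimage_box {M : Matrix (Fin 2) (Fin 2) ℝ} {c : ℝ}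
    (hc : ∀ z : ℤ × ℤ, z ≠ 0 → c ≤ |(latPt M z).1 * (latPt M z).2|) {x y s t : ℝ}
    (hst : s * t < c) :
    (latPt M ⁻¹' (Icc x (x + s) ×ˢ Icc y (y + t))).Subsingleton := by
  rintro z ⟨⟨h1, h2⟩, h3, h4⟩ z' ⟨⟨h1', h2'⟩, h3', h4'⟩
  by_contra hne
  have := hc (z - z') (sub_ne_zero.2 hne)
  have e1 : (latPt M (z - z')).1 = (latPt M z).1 - (latPt M z').1 := by
    simp only [latPt, Prod.fst_sub, Prod.snd_sub]; push_cast; ring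
  have e2 : (latPt M (z - z')).2 = (latPt M z).2 - (latPt M z').2 := by
    simp only [latPt, Prod.fst_sub, Prod.snd_sub]; push_cast; ring
  rw [e1, e2, abs_mul] at this
  have b1 : |(latPt M z).1 - (latPt M z').1| ≤ s := abs_le.2 ⟨by linarith, by linarith⟩
  have b2 : |(latPt M z).2 - (latPt M z').2| ≤ t := abs_le.2 ⟨by linarith, by linarith⟩
  have := mul_le_mul b1 b2 (abs_nonneg _) ((abs_nonneg _).trans b1)
  linarith

/-- Peeling off strips whose heights are second coordinates of primitive vectors shrinks the box
geometrically at bounded cost. -/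
lemma abs_ncard_box_sub_le {M : Matrix (Fin 2) (Fin 2) ℝ} (hM : 0 < M.det) {c : ℝ} (hc0 : 0 < c)
    (hc : ∀ z : ℤ × ℤ, z ≠ 0 → c ≤ |(latPt M z).1 * (latPt M z).2|) (n : ℕ) :
    ∀ x y s t : ℝ, 0 ≤ s → 0 ≤ t → s * t * (1 - c / (4 * M.det)) ^ n < c →
      (latPt M ⁻¹' (Icc x (x + s) ×ˢ Icc y (y + t))).Finite ∧
      |((latPt M ⁻¹' (Icc x (x + s) ×ˢ Icc y (y + t))).ncard : ℝ) - s * t / M.det|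
        ≤ 1 + c / M.det + 5 * n := by
  have base : ∀ x y s t : ℝ, 0 ≤ s → 0 ≤ t → s * t < c →
      (latPt M ⁻¹' (Icc x (x + s) ×ˢ Icc y (y + t))).Finite ∧
      |((latPt M ⁻¹' (Icc x (x + s) ×ˢ Icc y (y + t))).ncard : ℝ) - s * t / M.det|
        ≤ 1 + c / M.det := by
    intro x y s t hs ht hst
    have hsub := subsingleton_preimage_box hc (x := x) (y := y) hst
    refine ⟨hsub.finite, ?_⟩
    have h1 : ((latPt M ⁻¹' (Icc x (x + s) ×ˢ Icc y (y + t))).ncard : ℝ) ≤ 1 := by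
      have := hsub.finite.to_subtype
      exact_mod_cast ncard_le_one_iff_subsingleton.2 hsub
    have h2 : s * t / M.det ≤ c / M.det := by gcongr
    have h3 : 0 ≤ s * t / M.det := by positivity
    have h4 : (0 : ℝ) ≤ ((latPt M ⁻¹' (Icc x (x + s) ×ˢ Icc y (y + t))).ncard : ℝ) :=
      Nat.cast_nonneg _
    have h5 : 0 ≤ c / M.det := by positivity
    exact abs_le.2 ⟨by linarith, by linarith⟩
  induction n with
  | zero => intro x y s t hs ht hst; simpa using base x y s t hs ht (by simpa using hst)
  | succ n ih =>
    intro x y s t hs ht hst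
    rcases lt_or_ge (s * t) c with hlt | hge
    · obtain ⟨h1, h2⟩ := base x y s t hs ht hlt
      exact ⟨h1, h2.trans (by push_cast; linarith [(Nat.cast_nonneg n : (0 : ℝ) ≤ n)])⟩
    have ht0 : 0 < t := ht.lt_of_ne (by rintro rfl; simp at hge; linarith)
    obtain ⟨w, hw, hw1, hh0, hht⟩ := exists_isCoprime_latPt_le hM ht0
    have hwne : w ≠ 0 := by
      rintro rfl
      exact not_isCoprime_zero_zero hw
    have hcw := hc w hwne
    rw [abs_mul, abs_of_nonneg hh0] at hcw
    have hh : 0 < (latPt M w).2 := hh0.lt_of_ne (by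
      intro h
      rw [← h, mul_zero] at hcw
      linarith)
    have hstrip := abs_ncard_strip_sub_le hM hw hh x y hs
    set h := (latPt M w).2
    have hw1h : |(latPt M w).1| * h ≤ 2 * M.det := by
      calc |(latPt M w).1| * h ≤ 2 * M.det / t * t := by gcongr
        _ = 2 * M.det := by field_simp
    have hlow : c / (2 * M.det) * t ≤ h := by
      have : c ≤ 2 * M.det / t * h := hcw.trans (by gcongr)
      rw [div_mul_eq_mul_div, div_le_iff₀ (by positivity)]
      rw [div_mul_eq_mul_div, le_div_iff₀ ht0] at this
      linarith
    have hθ : 0 ≤ 1 - c / (4 * M.det) := by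
      rw [sub_nonneg, div_le_one (by positivity)]
      linarith
    have hrem : t - h ≤ t * (1 - c / (4 * M.det)) := by
      have e : c / (4 * M.det) = c / (2 * M.det) / 2 := by field_simp; norm_num
      have : 0 ≤ c / (2 * M.det) * t := by positivity
      rw [e]
      linarith
    obtain ⟨f2, b2⟩ := ih x (y + h) s (t - h) hs (by linarith) (by
      refine lt_of_le_of_lt ?_ hst
      calc s * (t - h) * (1 - c / (4 * M.det)) ^ n
          ≤ s * (t * (1 - c / (4 * M.det))) * (1 - c / (4 * M.det)) ^ n := by gcongr
        _ = s * t * (1 - c / (4 * M.det)) ^ (n + 1) := by ring)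
    obtain ⟨f1, b1⟩ := hstrip
    have e : y + h + (t - h) = y + t := by ring
    rw [e] at f2 b2
    have hun : latPt M ⁻¹' (Icc x (x + s) ×ˢ Icc y (y + t))
        = latPt M ⁻¹' (Icc x (x + s) ×ˢ Ico y (y + h)) ∪
          latPt M ⁻¹' (Icc x (x + s) ×ˢ Icc (y + h) (y + t)) := by
      rw [← preimage_union, ← prod_union, Ico_union_Icc_eq_Icc (by linarith) (by linarith)]
    have hdis : Disjoint (latPt M ⁻¹' (Icc x (x + s) ×ˢ Ico y (y + h)))
        (latPt M ⁻¹' (Icc x (x + s) ×ˢ Icc (y + h) (y + t))) := by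
      apply Disjoint.preimage
      rw [disjoint_prod]
      right
      rw [Set.disjoint_left]
      intro a ha hb
      exact absurd ha.2 (not_lt.2 hb.1)
    rw [hun]
    refine ⟨f1.union f2, ?_⟩
    rw [ncard_union_eq hdis f1 f2]
    have c1 : 2 * (|(latPt M w).1| * h) / M.det ≤ 4 := by
      rw [div_le_iff₀ hM]
      linarith
    have c2 : s * t / M.det = s * h / M.det + s * (t - h) / M.det := by ring
    rw [abs_le] at b1 b2 ⊢
    rw [c2]
    push_cast
    constructor <;> linarith

lemma exists_abs_ncard_box_sub_le_log {M : Matrix (Fin 2) (Fin 2) ℝ} (hM : 0 < M.det) {c : ℝ}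
    (hc0 : 0 < c) (hc : ∀ z : ℤ × ℤ, z ≠ 0 → c ≤ |(latPt M z).1 * (latPt M z).2|) :
    ∃ C : ℝ, 0 < C ∧ ∀ R : ℝ, 0 < R → ∀ x y s t : ℝ, 0 ≤ s → 0 ≤ t → s * t ≤ R ^ 2 →
      (latPt M ⁻¹' (Icc x (x + s) ×ˢ Icc y (y + t))).Finite ∧
      |((latPt M ⁻¹' (Icc x (x + s) ×ˢ Icc y (y + t))).ncard : ℝ) - s * t / M.det|
        ≤ C * Real.log (2 + R) := by
  set c' := min c M.det with hc'
  have hpos : 0 < c' := lt_min hc0 hM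
  have hcc : ∀ z : ℤ × ℤ, z ≠ 0 → c' ≤ |(latPt M z).1 * (latPt M z).2| :=
    fun z hz => (min_le_left _ _).trans (hc z hz)
  set θ := 1 - c' / (4 * M.det) with hθ
  have hθ0 : 0 < θ := by
    rw [hθ, sub_pos, div_lt_one (by positivity)]
    linarith [min_le_right c M.det]
  have hθ1 : θ < 1 := by
    have : 0 < c' / (4 * M.det) := by positivity
    linarith
  have hlθ : 0 < -Real.log θ := by linarith [Real.log_neg hθ0 hθ1]
  set K := 1 + c' / M.det + 5 with hK
  have hK0 : 0 < K := by positivity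
  refine ⟨2 * (K + 5 * (|Real.log c'| / -Real.log θ)) + 10 / -Real.log θ, by positivity, ?_⟩
  intro R hR x y s t hs ht hst
  set L := Real.log (2 + R) with hL
  have hL2 : 1 / 2 ≤ L := by
    have := Real.log_two_gt_d9
    have : Real.log 2 ≤ L := Real.log_le_log (by norm_num) (by linarith)
    linarith
  have hlR : Real.log R ≤ L := Real.log_le_log hR (by linarith)
  set q := (2 * L + |Real.log c'|) / -Real.log θ with hq
  have hq0 : 0 ≤ q := by positivity
  obtain ⟨h1, h2⟩ := abs_ncard_box_sub_le hM hpos hcc (⌊q⌋₊ + 1) x y s t hs ht (by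
    refine lt_of_le_of_lt (mul_le_mul_of_nonneg_right hst (pow_nonneg hθ0.le _)) ?_
    rw [← Real.log_lt_log_iff (by positivity) hpos, Real.log_mul (by positivity) (by positivity),
      Real.log_pow, Real.log_pow]
    have : q < ((⌊q⌋₊ + 1 : ℕ) : ℝ) := by push_cast; exact Nat.lt_floor_add_one q
    have := mul_lt_mul_of_pos_right this hlθ
    rw [show q * -Real.log θ = 2 * L + |Real.log c'| from div_mul_cancel₀ _ hlθ.ne'] at this
    rw [← hθ]
    push_cast at this ⊢
    linarith [neg_abs_le (Real.log c')])
  refine ⟨h1, h2.trans ?_⟩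
  have hfl : (⌊q⌋₊ : ℝ) ≤ q := Nat.floor_le hq0
  have hqe : q = 2 * L * (1 / -Real.log θ) + |Real.log c'| / -Real.log θ := by rw [hq]; ring
  have hB : 0 ≤ |Real.log c'| / -Real.log θ := by positivity
  push_cast
  calc 1 + c' / M.det + 5 * ((⌊q⌋₊ : ℝ) + 1) ≤ K + 5 * q := by rw [hK]; linarith
    _ = (K + 5 * (|Real.log c'| / -Real.log θ)) * 1 + 10 / -Real.log θ * L := by rw [hqe]; ring
    _ ≤ (K + 5 * (|Real.log c'| / -Real.log θ)) * (2 * L) + 10 / -Real.log θ * L := by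
      gcongr; linarith
    _ = _ := by ring

lemma scaleSet_dilate_latticeOf_inter_Icc (M : Matrix (Fin 2) (Fin 2) ℝ) {a τ : ℝ}
    (ha : 0 < a) (hτ : 0 < τ) (ρ η : Pt) :
    scaleSet a (dilate τ (latticeOf M)) ∩ Icc ρ (ρ + η) =
      (fun p : Pt => (a * (τ * p.1), a * (τ⁻¹ * p.2))) '' (latPt M ''
        (latPt M ⁻¹' (Icc (ρ.1 / (a * τ)) (ρ.1 / (a * τ) + η.1 / (a * τ)) ×ˢ
          Icc (ρ.2 * τ / a) (ρ.2 * τ / a + η.2 * τ / a)))) := by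
  have hp : (fun p : Pt => (a * (τ * p.1), a * (τ⁻¹ * p.2))) ⁻¹' Icc ρ (ρ + η) =
      Icc (ρ.1 / (a * τ)) (ρ.1 / (a * τ) + η.1 / (a * τ)) ×ˢ
        Icc (ρ.2 * τ / a) (ρ.2 * τ / a + η.2 * τ / a) := by
    ext p
    have h1 : ∀ u v : ℝ, u / (a * τ) ≤ v ↔ u ≤ a * (τ * v) := fun u v => by
      rw [div_le_iff₀ (by positivity)]; ring_nf
    have h2 : ∀ u v : ℝ, v ≤ u / (a * τ) ↔ a * (τ * v) ≤ u := fun u v => by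
      rw [le_div_iff₀ (by positivity)]; ring_nf
    have h3 : ∀ u v : ℝ, u * τ / a ≤ v ↔ u ≤ a * (τ⁻¹ * v) := fun u v => by
      rw [div_le_iff₀ ha, ← le_div_iff₀ hτ]; ring_nf
    have h4 : ∀ u v : ℝ, v ≤ u * τ / a ↔ a * (τ⁻¹ * v) ≤ u := fun u v => by
      rw [le_div_iff₀ ha, ← div_le_iff₀ hτ]; ring_nf
    simp only [mem_preimage, mem_Icc, mem_prod, Prod.le_def, Prod.fst_add, Prod.snd_add,
      ← add_div, ← add_mul, h1, h2, h3, h4]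
    tauto
  rw [image_preimage_eq_inter_range, ← latticeOf_eq_range, ← hp, inter_comm (_ ⁻¹' _),
    image_inter_preimage, scaleSet, dilate, image_image]

lemma starDiscShift_admissible_lattice_of_det_pos {M : Matrix (Fin 2) (Fin 2) ℝ} (hM : 0 < M.det)
    (hadm : IsAdmissible (latticeOf M)) :
    ∃ C : ℝ, ∀ a : ℝ, 0 < a → a < 1 → ∀ τ : ℝ, 0 < τ →
      starDiscShift (scaleSet a (dilate τ (latticeOf M))) ≤ C * a ^ 2 * Real.log (2 + a⁻¹) := by
  obtain ⟨c, hc0, hc⟩ := hadm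
  have hinj := latPt_injective hM.ne'
  obtain ⟨C, hC0, hC⟩ := exists_abs_ncard_box_sub_le_log hM hc0 (fun z hz => by
    refine hc _ (latticeOf_eq_range M ▸ mem_range_self z) fun h => hz (hinj ?_)
    rw [h]
    simp [latPt, Prod.zero_eq_mk])
  refine ⟨4 * M.det * C, fun a ha _ τ hτ => ?_⟩
  have hlog : 0 < Real.log (2 + a⁻¹) := Real.log_pos (by linarith [inv_pos.2 ha])
  set Λ := scaleSet a (dilate τ (latticeOf M))
  set E := C * Real.log (2 + a⁻¹)
  have hE : 0 < E := by positivity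
  have hmap : Function.Injective (fun p : Pt => (a * (τ * p.1), a * (τ⁻¹ * p.2))) := by
    intro p q h
    simp only [Prod.mk.injEq] at h
    exact Prod.ext (mul_left_cancel₀ hτ.ne' (mul_left_cancel₀ ha.ne' h.1))
      (mul_left_cancel₀ (inv_pos.2 hτ).ne' (mul_left_cancel₀ ha.ne' h.2))
  have count : ∀ ρ η : Pt, 0 ≤ η → η ≤ 1 → (Λ ∩ Icc ρ (ρ + η)).Finite ∧
      |((Λ ∩ Icc ρ (ρ + η)).ncard : ℝ) - η.1 * η.2 / (a ^ 2 * M.det)| ≤ E := by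
    intro ρ η h0 h1
    have hx0 : 0 ≤ η.1 := h0.1
    have hy0 : 0 ≤ η.2 := h0.2
    have hx1 : η.1 ≤ 1 := h1.1
    have hy1 : η.2 ≤ 1 := h1.2
    have hst : η.1 / (a * τ) * (η.2 * τ / a) = η.1 * η.2 / a ^ 2 := by field_simp
    obtain ⟨hf, hb⟩ := hC a⁻¹ (inv_pos.2 ha) (ρ.1 / (a * τ)) (ρ.2 * τ / a) (η.1 / (a * τ))
      (η.2 * τ / a) (by positivity) (by positivity) (by
        rw [hst, inv_pow, ← one_div]
        gcongr
        exact mul_le_one₀ hx1 hy0 hy1)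
    rw [scaleSet_dilate_latticeOf_inter_Icc M ha hτ]
    refine ⟨(hf.image _).image _, ?_⟩
    rw [ncard_image_of_injective _ hmap, ncard_image_of_injective _ hinj]
    rwa [hst, div_div] at hb
  have hrhs : 0 ≤ 4 * M.det * C * a ^ 2 * Real.log (2 + a⁻¹) := by positivity
  refine Real.iSup_le (fun ρ => Real.iSup_le (fun ⟨η, h0, h1⟩ => ?_) hrhs) hrhs
  simp only [nPts]
  have hx0 : 0 ≤ η.1 := h0.1
  have hy0 : 0 ≤ η.2 := h0.2
  have hxy1 : η.1 * η.2 ≤ 1 := mul_le_one₀ h1.1 hy0 h1.2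
  have hxy0 : 0 ≤ η.1 * η.2 := mul_nonneg hx0 hy0
  obtain ⟨hNfin, hN⟩ := count ρ 1 zero_le_one le_rfl
  obtain ⟨-, hn⟩ := count ρ η h0 h1
  have hle : ((Λ ∩ Icc ρ (ρ + η)).ncard : ℝ) ≤ (Λ ∩ Icc ρ (ρ + 1)).ncard := by
    refine Nat.cast_le.2 (ncard_le_ncard ?_ hNfin)
    exact inter_subset_inter_right _ (Icc_subset_Icc_right (add_le_add_right h1 ρ))
  have hn0 : (0 : ℝ) ≤ (Λ ∩ Icc ρ (ρ + η)).ncard := Nat.cast_nonneg _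
  generalize ((Λ ∩ Icc ρ (ρ + η)).ncard : ℝ) = n at *
  generalize ((Λ ∩ Icc ρ (ρ + 1)).ncard : ℝ) = N at *
  generalize η.1 * η.2 = e at *
  simp only [Prod.fst_one, Prod.snd_one, mul_one] at hN
  have hV : 0 < a ^ 2 * M.det := by positivity
  rw [show 4 * M.det * C * a ^ 2 * Real.log (2 + a⁻¹) = 4 * E * (a ^ 2 * M.det) by
    simp only [E]; ring]
  set V := a ^ 2 * M.det
  rcases le_or_gt (1 / (2 * V)) N with hbig | hsmall
  · have hN0 : 0 < N := lt_of_lt_of_le (by positivity) hbig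
    have hnum : |n - e * N| ≤ 2 * E := by
      calc |n - e * N| = |(n - e / V) - e * (N - 1 / V)| := by congr 1; ring
        _ ≤ |n - e / V| + |e * (N - 1 / V)| := abs_sub _ _
        _ = |n - e / V| + e * |N - 1 / V| := by rw [abs_mul, abs_of_nonneg hxy0]
        _ ≤ E + 1 * E := by gcongr
        _ = 2 * E := by ring
    rw [show n / N - e = (n - e * N) / N by field_simp, abs_div, abs_of_pos hN0, div_le_iff₀ hN0]
    rw [div_le_iff₀ (by positivity)] at hbig
    nlinarith
  · have h1' : |n / N - e| ≤ 1 := by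
      have : 0 ≤ n / N := div_nonneg hn0 (hn0.trans hle)
      have : n / N ≤ 1 := div_le_one_of_le₀ hle (hn0.trans hle)
      exact abs_le.2 ⟨by linarith, by linarith⟩
    have h2 : 1 / V = 2 * (1 / (2 * V)) := by field_simp
    have h3 : 1 / (2 * V) ≤ E := by linarith [(abs_le.1 hN).1]
    rw [div_le_iff₀ (by positivity)] at h3
    linarith [mul_pos hE hV]

/-- **Discrepancy of admissible lattices** (after Skriganov): there is `C = C(Γ)` with
`D*_shift(aΓ_τ) ≤ C a² ln(2 + a⁻¹)` uniformly over all `a ∈ (0,1)` and `τ > 0`. -/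
theorem starDiscShift_admissible_lattice (M : Matrix (Fin 2) (Fin 2) ℝ)
    (hM : M.det ≠ 0) (Γ : Set Pt) (hΓ : Γ = latticeOf M) (hadm : IsAdmissible Γ) :
    ∃ C : ℝ, ∀ a : ℝ, 0 < a → a < 1 → ∀ τ : ℝ, 0 < τ →
      starDiscShift (scaleSet a (dilate τ Γ)) ≤ C * a ^ 2 * Real.log (2 + a⁻¹) := by
  subst hΓ
  rcases lt_or_gt_of_ne hM with h | h
  · have hswap : latticeOf M = latticeOf (M.submatrix id (Equiv.swap 0 1)) := by
      ext p
      simp only [latticeOf, mem_ofPred_eq, Matrix.submatrix_apply, id, Equiv.swap_apply_left,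
        Equiv.swap_apply_right]
      rw [exists_comm]
      simp only [add_comm]
    rw [hswap] at hadm ⊢
    refine starDiscShift_admissible_lattice_of_det_pos ?_ hadm
    rw [Matrix.det_permute']
    simpa using h
  · exact starDiscShift_admissible_lattice_of_det_pos h hadm
end
end

section
/- Let d ∈ ℕ, let Λ ⊂ ℝ^d be a discrete set such that every translated unit cube ρ + [0,1]^d (ρ ∈ ℝ^d) contains at least one point of Λ, and let h ∈ L¹(ℝ^d) have continuous mixed partial derivatives ∂_u h ∈ L¹(ℝ^d) for every nonempty subset u ⊂ {1,…,d}. Then the weighted quadrature error e(h,Λ) = ∫_{ℝ^d} h − Σ_{λ∈Λ} a_λ h(λ), with weights a_λ = ∫_{ℝ^d} χ_{ρ+[0,1]^d}(λ)/N_ρ dρ, satisfies |e(h,Λ)| ≤ D*_shift(Λ) · Σ_{∅≠u⊂{1,…,d}} ‖∂_u h‖_{L¹(ℝ^d)}. -/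
open MeasureTheory Set Real

noncomputable section

abbrev Ptd (d : ℕ) : Type := Fin d → ℝ

/-- Number of points of `Λ` in the translated unit cube `ρ + [0,1]^d`. -/
def nPtsD {d : ℕ} (Λ : Set (Ptd d)) (ρ : Ptd d) : ℕ := (Λ ∩ Icc ρ (ρ + 1)).ncard

/-- Quadrature weight `a_λ = ∫_{ℝ^d} χ_{ρ+[0,1]^d}(λ)/N_ρ dρ`. -/
def qweightD {d : ℕ} (Λ : Set (Ptd d)) (p : Ptd d) : ℝ :=
  ∫ ρ : Ptd d, (Icc ρ (ρ + 1)).indicator (fun _ => (1 : ℝ)) p / (nPtsD Λ ρ : ℝ)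

/-- Shifted star discrepancy on `ℝ^d`. -/
def starDiscShiftD {d : ℕ} (Λ : Set (Ptd d)) : ℝ :=
  ⨆ ρ : Ptd d, ⨆ η : Icc (0 : Ptd d) 1,
    |((Λ ∩ Icc ρ (ρ + (η : Ptd d))).ncard : ℝ) / (nPtsD Λ ρ : ℝ) -
      ∏ i : Fin d, (η : Ptd d) i|

/-- Partial derivative in the `i`-th coordinate. -/
def pderivI {d : ℕ} (i : Fin d) (h : Ptd d → ℂ) : Ptd d → ℂ :=
  fun x => deriv (fun t => h (Function.update x i t)) (x i)

/-- Mixed partial derivative `∂_u h` in the coordinates listed in `u`. -/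
def pderivU {d : ℕ} (u : Finset (Fin d)) (h : Ptd d → ℂ) : Ptd d → ℂ :=
  (u.sort (· ≤ ·)).foldr pderivI h

/-- Lebesgue measure on the closed unit cube. -/
def cubeMeasure (d : ℕ) : Measure (Ptd d) := volume.restrict (Icc 0 1)

instance isProbabilityMeasure_restrict_unitInterval :
    IsProbabilityMeasure ((volume : Measure ℝ).restrict (Icc 0 1)) := ⟨by simp⟩

theorem cubeMeasure_eq_pi (d : ℕ) :
    cubeMeasure d = Measure.pi (fun _ : Fin d => (volume : Measure ℝ).restrict (Icc 0 1)) := by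
  rw [← Measure.restrict_pi_pi, cubeMeasure, ← volume_pi]
  congr 1
  exact (pi_univ_Icc (0 : Ptd d) 1).symm

instance isProbabilityMeasure_cubeMeasure (d : ℕ) : IsProbabilityMeasure (cubeMeasure d) := by
  rw [cubeMeasure_eq_pi]; infer_instance

theorem ae_cubeMeasure_mem (d : ℕ) : ∀ᵐ x ∂cubeMeasure d, x ∈ Icc (0 : Ptd d) 1 :=
  ae_restrict_mem measurableSet_Icc

theorem Continuous.integrable_cubeMeasure {d : ℕ} {E : Type*} [NormedAddCommGroup E]
    {f : Ptd d → E} (hf : Continuous f) : Integrable f (cubeMeasure d) :=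
  hf.integrableOn_Icc

/-- Resampling one coordinate preserves the uniform measure on the cube. -/
theorem measurePreserving_update_cubeMeasure {d : ℕ} (a : Fin d) :
    MeasurePreserving (fun z : Ptd d × ℝ => Function.update z.1 a z.2)
      ((cubeMeasure d).prod ((volume : Measure ℝ).restrict (Icc 0 1))) (cubeMeasure d) := by
  have hm : Measurable (fun z : Ptd d × ℝ => Function.update z.1 a z.2) :=
    (continuous_fst.update a continuous_snd).measurable
  refine ⟨hm, ?_⟩
  conv_rhs => rw [cubeMeasure_eq_pi]
  refine (Measure.pi_eq fun s hs => ?_).symm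
  rw [Measure.map_apply hm (MeasurableSet.univ_pi hs)]
  have hpre : (fun z : Ptd d × ℝ => Function.update z.1 a z.2) ⁻¹' (univ.pi s) =
      (univ.pi (Function.update s a univ)) ×ˢ s a := by
    ext z
    simp only [mem_preimage, mem_univ_pi, mem_prod]
    constructor
    · intro hz
      refine ⟨fun i => ?_, by simpa using hz a⟩
      rcases eq_or_ne i a with rfl | hi
      · simp
      · simpa [hi] using hz i
    · rintro ⟨h1, h2⟩ i
      rcases eq_or_ne i a with rfl | hi
      · simpa using h2
      · simpa [hi] using h1 i
  rw [hpre, Measure.prod_prod, cubeMeasure_eq_pi, Measure.pi_pi,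
    ← Finset.mul_prod_erase _ _ (Finset.mem_univ a), ← Finset.mul_prod_erase _ _ (Finset.mem_univ a)]
  rw [Function.update_self, measure_univ, one_mul, mul_comm]
  congr 1
  refine Finset.prod_congr rfl fun i hi => ?_
  rw [Function.update_of_ne (Finset.ne_of_mem_erase hi)]

theorem integral_cubeMeasure_update {d : ℕ} (a : Fin d) {f : Ptd d → ℂ}
    (hf : Integrable f (cubeMeasure d)) :
    ∫ η, f η ∂cubeMeasure d =
      ∫ η, (∫ t in Icc (0 : ℝ) 1, f (Function.update η a t)) ∂cubeMeasure d := by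
  have hp := measurePreserving_update_cubeMeasure a
  have hi : Integrable (fun z : Ptd d × ℝ => f (Function.update z.1 a z.2))
      ((cubeMeasure d).prod ((volume : Measure ℝ).restrict (Icc 0 1))) :=
    hp.integrable_comp_of_integrable hf
  rw [← integral_prod (fun z : Ptd d × ℝ => f (Function.update z.1 a z.2)) hi]
  conv_lhs => rw [← hp.map_eq]
  rw [integral_map hp.measurable.aemeasurable]
  rw [hp.map_eq]; exact hf.1

theorem cubeMeasure_real_Iic {d : ℕ} {y : Ptd d} (hy : y ∈ Icc (0 : Ptd d) 1) :
    (cubeMeasure d).real (Iic y) = ∏ i, y i := by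
  have : Iic y ∩ Icc (0 : Ptd d) 1 = Icc 0 y := by
    ext x
    exact ⟨fun h => ⟨h.2.1, h.1⟩, fun h => ⟨h.2, h.1, h.2.trans hy.2⟩⟩
  rw [measureReal_def, cubeMeasure, Measure.restrict_apply measurableSet_Iic, this,
    Real.volume_Icc_pi_toReal hy.1]
  simp

theorem pderivU_insert {d : ℕ} {a : Fin d} {u : Finset (Fin d)} (ha : ∀ i ∈ u, a < i)
    (h : Ptd d → ℂ) : pderivU (insert a u) h = pderivI a (pderivU u h) := by
  rw [pderivU, Finset.sort_insert _ (fun b hb => (ha b hb).le) (fun hmem => (ha a hmem).false)]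
  rfl

theorem pderivU_empty {d : ℕ} (h : Ptd d → ℂ) : pderivU ∅ h = h := by
  simp [pderivU]

/-- The fundamental theorem of calculus along a coordinate line. -/
theorem setIntegral_pderivI_update {d : ℕ} {g : Ptd d → ℂ} {a : Fin d}
    (hg : ∀ x : Ptd d, DifferentiableAt ℝ (fun t => g (Function.update x a t)) (x a))
    (hc : Continuous (pderivI a g)) (y : Ptd d) (r : ℝ) {s : ℝ} (hs : s ∈ Icc (0 : ℝ) 1) :
    ∫ t in Icc (0 : ℝ) 1, (if s ≤ t then pderivI a g (Function.update y a (r + t)) else 0) =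
      g (Function.update y a (r + 1)) - g (Function.update y a (r + s)) := by
  have hder (t : ℝ) : HasDerivAt (fun t => g (Function.update y a t))
      (pderivI a g (Function.update y a t)) t := by
    have := (hg (Function.update y a t)).hasDerivAt
    simpa [pderivI] using this
  have hder' (t : ℝ) : HasDerivAt (fun t => g (Function.update y a (r + t)))
      (pderivI a g (Function.update y a (r + t))) t :=
    (hder (r + t)).comp_const_add r t
  have hcont : Continuous fun t : ℝ => pderivI a g (Function.update y a (r + t)) :=
    hc.comp (continuous_const.update a (by fun_prop))
  rw [← intervalIntegral.integral_eq_sub_of_hasDerivAt (fun t _ => hder' t)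
      (hcont.intervalIntegrable s 1), intervalIntegral.integral_of_le hs.2,
    ← integral_Icc_eq_integral_Ioc]
  have : Icc s 1 = Icc (0 : ℝ) 1 ∩ Ici s := by
    ext t
    exact ⟨fun h => ⟨⟨hs.1.trans h.1, h.2⟩, h.1⟩, fun h => ⟨h.2, h.1.2⟩⟩
  rw [this, ← setIntegral_indicator measurableSet_Ici]
  rfl

/-- The point `ρ + p`, with the offset in the coordinates of `S` replaced by that of `η` on `u`
and by `1` off `u`. -/
def mixedPoint {d : ℕ} (S u : Finset (Fin d)) (ρ p η : Ptd d) : Ptd d :=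
  fun i => ρ i + if i ∈ S then (if i ∈ u then η i else 1) else p i

theorem continuous_mixedPoint {d : ℕ} (S u : Finset (Fin d)) (ρ p : Ptd d) :
    Continuous (mixedPoint S u ρ p) := by
  refine continuous_pi fun i => ?_
  unfold mixedPoint
  split_ifs <;> fun_prop

theorem measurableSet_forall_mem_le {d : ℕ} (u : Finset (Fin d)) (p : Ptd d) :
    MeasurableSet {η : Ptd d | ∀ i ∈ u, p i ≤ η i} := by
  have : {η : Ptd d | ∀ i ∈ u, p i ≤ η i} = ⋂ i ∈ u, {η : Ptd d | p i ≤ η i} := by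
    ext; simp
  rw [this]
  exact Finset.measurableSet_biInter u fun i _ =>
    measurableSet_le measurable_const (measurable_pi_apply i)

open Classical in
theorem integrable_ite_forall_mem_le {d : ℕ} (u : Finset (Fin d)) (p : Ptd d) {f : Ptd d → ℂ}
    (hf : Continuous f) :
    Integrable (fun η => if ∀ i ∈ u, p i ≤ η i then f η else 0) (cubeMeasure d) :=
  (hf.integrable_cubeMeasure.indicator (measurableSet_forall_mem_le u p)).congr
    (.of_forall fun η => by simp [indicator])

open Classical in
/-- Iterated fundamental theorem of calculus, anchored at the upper corner of a unit cube, in the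
coordinates of `S`. -/
theorem eq_sum_powerset_integral_pderivU {d : ℕ} {h : Ptd d → ℂ}
    (hdiff : ∀ u : Finset (Fin d), ∀ i : Fin d, ∀ x : Ptd d,
      DifferentiableAt ℝ (fun t => pderivU u h (Function.update x i t)) (x i))
    (hsm : ∀ u : Finset (Fin d), Continuous (pderivU u h))
    (ρ : Ptd d) {p : Ptd d} (hp : p ∈ Icc (0 : Ptd d) 1) (S : Finset (Fin d)) :
    h (ρ + p) = ∑ u ∈ S.powerset, (-1 : ℂ) ^ u.card *
      ∫ η, (if ∀ i ∈ u, p i ≤ η i then pderivU u h (mixedPoint S u ρ p η) else 0)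
        ∂cubeMeasure d := by
  induction S using Finset.induction_on_min with
  | empty =>
    have : ∀ η, mixedPoint ∅ ∅ ρ p η = ρ + p := fun η => by ext i; simp [mixedPoint]
    simp [pderivU_empty, this]
  | insert a S haS ih =>
    have ha : a ∉ S := fun hmem => (haS a hmem).false
    rw [ih, Finset.sum_powerset_insert ha, ← Finset.sum_add_distrib]
    refine Finset.sum_congr rfl fun u hu => ?_
    have huS : u ⊆ S := Finset.mem_powerset.1 hu
    have hau : a ∉ u := fun hmem => ha (huS hmem)
    have hins := pderivU_insert (fun i hi => haS i (huS hi)) h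
    rw [Finset.card_insert_of_notMem hau, pow_succ, mul_assoc, ← mul_add]
    congr 1
    have hI (A v : Finset (Fin d)) := integrable_ite_forall_mem_le v p
      ((hsm v).comp (continuous_mixedPoint A v ρ p))
    simp only [Function.comp_apply] at hI
    have key : ∫ η, (if ∀ i ∈ insert a u, p i ≤ η i then
          pderivU (insert a u) h (mixedPoint (insert a S) (insert a u) ρ p η) else 0)
          ∂cubeMeasure d =
        (∫ η, (if ∀ i ∈ u, p i ≤ η i then pderivU u h (mixedPoint (insert a S) u ρ p η) else 0)
          ∂cubeMeasure d) -
        ∫ η, (if ∀ i ∈ u, p i ≤ η i then pderivU u h (mixedPoint S u ρ p η) else 0)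
          ∂cubeMeasure d := by
      rw [integral_cubeMeasure_update a (hI _ _), ← integral_sub (hI _ _) (hI _ _)]
      refine integral_congr_ae (.of_forall fun η => ?_)
      have hone : Function.update (mixedPoint S u ρ p η) a (ρ a + 1) =
          mixedPoint (insert a S) u ρ p η := by
        ext i
        rcases eq_or_ne i a with rfl | hi
        · simp [mixedPoint, hau]
        · simp [mixedPoint, hi]
      have hself : Function.update (mixedPoint S u ρ p η) a (ρ a + p a) =
          mixedPoint S u ρ p η := by
        ext i
        rcases eq_or_ne i a with rfl | hi
        · simp [mixedPoint, ha]
        · simp [hi]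
      have hvar (t : ℝ) : mixedPoint (insert a S) (insert a u) ρ p (Function.update η a t) =
          Function.update (mixedPoint S u ρ p η) a (ρ a + t) := by
        ext i
        rcases eq_or_ne i a with rfl | hi
        · simp [mixedPoint]
        · simp [mixedPoint, hi]
      have hcond (t : ℝ) : (∀ i ∈ insert a u, p i ≤ Function.update η a t i) ↔
          (∀ i ∈ u, p i ≤ η i) ∧ p a ≤ t := by
        rw [Finset.forall_mem_insert, and_comm, Function.update_self]
        refine and_congr (forall₂_congr fun i hi => ?_) Iff.rfl
        rw [Function.update_of_ne (ne_of_mem_of_not_mem hi hau)]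
      simp only [hcond, hvar, hins]
      by_cases hc : ∀ i ∈ u, p i ≤ η i
      · simp only [eq_true hc, true_and, if_true]
        rw [setIntegral_pderivI_update (hdiff u a) (hins ▸ hsm _) _ _ ⟨hp.1 a, hp.2 a⟩, hone, hself]
      · simp [hc]
    rw [key]
    ring

/-- The offset equal to `η` on `u` and to `1` off `u`. -/
def faceOffset {d : ℕ} (u : Finset (Fin d)) (η : Ptd d) : Ptd d :=
  fun i => if i ∈ u then η i else 1

theorem continuous_faceOffset {d : ℕ} (u : Finset (Fin d)) : Continuous (faceOffset u) := by
  refine continuous_pi fun i => ?_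
  unfold faceOffset
  split_ifs <;> fun_prop

theorem faceOffset_mem {d : ℕ} (u : Finset (Fin d)) {η : Ptd d} (hη : η ∈ Icc (0 : Ptd d) 1) :
    faceOffset u η ∈ Icc (0 : Ptd d) 1 := by
  constructor <;> intro i <;> unfold faceOffset <;> split_ifs
  · exact hη.1 i
  · simp
  · exact hη.2 i
  · simp

open Classical in
theorem eq_sum_integral_pderivU {d : ℕ} {h : Ptd d → ℂ}
    (hdiff : ∀ u : Finset (Fin d), ∀ i : Fin d, ∀ x : Ptd d,
      DifferentiableAt ℝ (fun t => pderivU u h (Function.update x i t)) (x i))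
    (hsm : ∀ u : Finset (Fin d), Continuous (pderivU u h))
    (ρ : Ptd d) {p : Ptd d} (hp : p ∈ Icc (0 : Ptd d) 1) :
    h (ρ + p) = ∑ u : Finset (Fin d), (-1 : ℂ) ^ u.card *
      ∫ η, (if p ≤ faceOffset u η then pderivU u h (ρ + faceOffset u η) else 0)
        ∂cubeMeasure d := by
  rw [eq_sum_powerset_integral_pderivU hdiff hsm ρ hp Finset.univ, Finset.powerset_univ]
  refine Finset.sum_congr rfl fun u _ => ?_
  congr 2
  ext η
  have hcond : (∀ i ∈ u, p i ≤ η i) ↔ p ≤ faceOffset u η := by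
    refine forall_congr' fun i => ?_
    unfold faceOffset
    split_ifs with hi
    · simp [hi]
    · simpa [hi] using hp.2 i
  have hpt : mixedPoint Finset.univ u ρ p η = ρ + faceOffset u η := by
    ext i; simp [mixedPoint, faceOffset]
  simp only [hcond, hpt]

theorem norm_le_sum_integral_norm_pderivU {d : ℕ} {h : Ptd d → ℂ}
    (hdiff : ∀ u : Finset (Fin d), ∀ i : Fin d, ∀ x : Ptd d,
      DifferentiableAt ℝ (fun t => pderivU u h (Function.update x i t)) (x i))
    (hsm : ∀ u : Finset (Fin d), Continuous (pderivU u h))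
    (ρ : Ptd d) {p : Ptd d} (hp : p ∈ Icc (0 : Ptd d) 1) :
    ‖h (ρ + p)‖ ≤ ∑ u : Finset (Fin d),
      ∫ η, ‖pderivU u h (ρ + faceOffset u η)‖ ∂cubeMeasure d := by
  classical
  rw [eq_sum_integral_pderivU hdiff hsm ρ hp]
  refine (norm_sum_le _ _).trans (Finset.sum_le_sum fun u _ => ?_)
  rw [norm_mul, norm_pow, norm_neg, norm_one, one_pow, one_mul]
  refine norm_integral_le_of_norm_le ?_ (.of_forall fun η => ?_)
  · exact Continuous.integrable_cubeMeasure
      ((hsm u).comp (continuous_const.add (continuous_faceOffset u))).norm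
  · split_ifs <;> simp

open Classical in
theorem integral_eq_sum_integral_pderivU {d : ℕ} {h : Ptd d → ℂ}
    (hdiff : ∀ u : Finset (Fin d), ∀ i : Fin d, ∀ x : Ptd d,
      DifferentiableAt ℝ (fun t => pderivU u h (Function.update x i t)) (x i))
    (hsm : ∀ u : Finset (Fin d), Continuous (pderivU u h)) (ρ : Ptd d) :
    ∫ x, h (ρ + x) ∂cubeMeasure d = ∑ u : Finset (Fin d), (-1 : ℂ) ^ u.card *
      ∫ η, ((∏ i, faceOffset u η i : ℝ) : ℂ) * pderivU u h (ρ + faceOffset u η)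
        ∂cubeMeasure d := by
  have hg (u : Finset (Fin d)) : Continuous fun η => pderivU u h (ρ + faceOffset u η) :=
    (hsm u).comp (continuous_const.add (continuous_faceOffset u))
  have hI (u : Finset (Fin d)) : Integrable (Function.uncurry fun x η : Ptd d =>
      if x ≤ faceOffset u η then pderivU u h (ρ + faceOffset u η) else 0)
      ((cubeMeasure d).prod (cubeMeasure d)) := by
    have hs : MeasurableSet {z : Ptd d × Ptd d | z.1 ≤ faceOffset u z.2} :=
      (isClosed_le continuous_fst ((continuous_faceOffset u).comp continuous_snd)).measurableSet
    exact ((hg u).integrable_cubeMeasure.comp_snd (cubeMeasure d)).indicator hs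
  have hcongr := integral_congr_ae ((ae_cubeMeasure_mem d).mono fun x hx =>
    eq_sum_integral_pderivU hdiff hsm ρ hx)
  rw [hcongr, integral_finsetSum]
  · refine Finset.sum_congr rfl fun u _ => ?_
    rw [integral_const_mul, integral_integral_swap (hI u)]
    congr 1
    refine integral_congr_ae ((ae_cubeMeasure_mem d).mono fun η hη => ?_)
    have := integral_indicator_const (μ := cubeMeasure d) (pderivU u h (ρ + faceOffset u η))
      (measurableSet_Iic (a := faceOffset u η))
    rw [cubeMeasure_real_Iic (faceOffset_mem u hη), Complex.real_smul] at this
    exact this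
  · exact fun u _ => (hI u).integral_prod_left.const_mul _

theorem abs_sub_prod_le_starDiscShiftD {d : ℕ} {Λ : Set (Ptd d)}
    (hfin : ∀ ρ : Ptd d, (Λ ∩ Icc ρ (ρ + 1)).Finite) (ρ : Ptd d) {η : Ptd d}
    (hη : η ∈ Icc (0 : Ptd d) 1) :
    |((Λ ∩ Icc ρ (ρ + η)).ncard : ℝ) / (nPtsD Λ ρ : ℝ) - ∏ i, η i| ≤ starDiscShiftD Λ := by
  have hb (ρ : Ptd d) (η : Icc (0 : Ptd d) 1) :
      |((Λ ∩ Icc ρ (ρ + (η : Ptd d))).ncard : ℝ) / (nPtsD Λ ρ : ℝ) - ∏ i, (η : Ptd d) i| ≤ 1 := by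
    have h1 : ((Λ ∩ Icc ρ (ρ + (η : Ptd d))).ncard : ℝ) ≤ nPtsD Λ ρ := by
      refine Nat.cast_le.2 (ncard_le_ncard ?_ (hfin ρ))
      exact inter_subset_inter_right _ (Icc_subset_Icc_right (by gcongr; exact η.2.2))
    have h2 := div_le_one_of_le₀ h1 (Nat.cast_nonneg _)
    have h3 : 0 ≤ ((Λ ∩ Icc ρ (ρ + (η : Ptd d))).ncard : ℝ) / (nPtsD Λ ρ : ℝ) := by positivity
    have h4 : 0 ≤ ∏ i, (η : Ptd d) i := Finset.prod_nonneg fun i _ => η.2.1 i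
    have h5 : ∏ i, (η : Ptd d) i ≤ 1 :=
      Finset.prod_le_one (fun i _ => η.2.1 i) fun i _ => η.2.2 i
    rw [abs_le]
    constructor <;> linarith
  have : Nonempty (Icc (0 : Ptd d) 1) := ⟨⟨0, by simp⟩⟩
  exact (le_ciSup (f := fun η : Icc (0 : Ptd d) 1 =>
      |((Λ ∩ Icc ρ (ρ + (η : Ptd d))).ncard : ℝ) / (nPtsD Λ ρ : ℝ) - ∏ i, (η : Ptd d) i|)
      ⟨1, forall_mem_range.2 (hb ρ)⟩ ⟨η, hη⟩).trans
    (le_ciSup (f := fun ρ : Ptd d => ⨆ η : Icc (0 : Ptd d) 1,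
      |((Λ ∩ Icc ρ (ρ + (η : Ptd d))).ncard : ℝ) / (nPtsD Λ ρ : ℝ) - ∏ i, (η : Ptd d) i|)
      ⟨1, forall_mem_range.2 fun ρ => ciSup_le (hb ρ)⟩ ρ)

open Classical in
theorem ncard_mul_eq_sum_ite {d : ℕ} {Λ : Set (Ptd d)} {ρ : Ptd d}
    (hρ : (Λ ∩ Icc ρ (ρ + 1)).Finite) {y : Ptd d} (hy : y ≤ 1) (c : ℂ) :
    ((Λ ∩ Icc ρ (ρ + y)).ncard : ℂ) * c =
      ∑ p ∈ hρ.toFinset, if p - ρ ≤ y then c else 0 := by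
  have hset : (Λ ∩ Icc ρ (ρ + y)) = ↑(hρ.toFinset.filter fun p => p - ρ ≤ y) := by
    ext p
    simp only [Finset.coe_filter, Finite.mem_toFinset, mem_inter_iff, mem_ofPred_eq, mem_Icc,
      sub_le_iff_le_add']
    have hle : ρ + y ≤ ρ + 1 := by gcongr
    exact ⟨fun ⟨a, b, c⟩ => ⟨⟨a, b, c.trans hle⟩, c⟩, fun ⟨⟨a, b, _⟩, c⟩ => ⟨a, b, c⟩⟩
  rw [hset, ncard_coe_finset, ← Finset.sum_filter, Finset.sum_const, nsmul_eq_mul]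

open Classical in
theorem integrable_ite_le_faceOffset {d : ℕ} (u : Finset (Fin d)) (p : Ptd d) {f : Ptd d → ℂ}
    (hf : Continuous f) :
    Integrable (fun η => if p ≤ faceOffset u η then f η else 0) (cubeMeasure d) := by
  have hs : MeasurableSet {η : Ptd d | p ≤ faceOffset u η} :=
    (isClosed_le continuous_const (continuous_faceOffset u)).measurableSet
  exact hf.integrable_cubeMeasure.indicator hs

theorem integrable_ncard_mul {d : ℕ} {Λ : Set (Ptd d)} {ρ : Ptd d}
    (hρ : (Λ ∩ Icc ρ (ρ + 1)).Finite) (u : Finset (Fin d)) {f : Ptd d → ℂ} (hf : Continuous f) :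
    Integrable (fun η => ((Λ ∩ Icc ρ (ρ + faceOffset u η)).ncard : ℂ) * f η) (cubeMeasure d) := by
  classical
  refine (integrable_finsetSum hρ.toFinset fun p _ =>
    integrable_ite_le_faceOffset u (p - ρ) hf).congr ?_
  exact (ae_cubeMeasure_mem d).mono fun η hη =>
    (ncard_mul_eq_sum_ite hρ (faceOffset_mem u hη).2 (f η)).symm

theorem sum_eq_sum_integral_pderivU {d : ℕ} {Λ : Set (Ptd d)} {h : Ptd d → ℂ}
    (hdiff : ∀ u : Finset (Fin d), ∀ i : Fin d, ∀ x : Ptd d,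
      DifferentiableAt ℝ (fun t => pderivU u h (Function.update x i t)) (x i))
    (hsm : ∀ u : Finset (Fin d), Continuous (pderivU u h))
    {ρ : Ptd d} (hρ : (Λ ∩ Icc ρ (ρ + 1)).Finite) :
    ∑ p ∈ hρ.toFinset, h p = ∑ u : Finset (Fin d), (-1 : ℂ) ^ u.card *
      ∫ η, ((Λ ∩ Icc ρ (ρ + faceOffset u η)).ncard : ℂ) * pderivU u h (ρ + faceOffset u η)
        ∂cubeMeasure d := by
  classical
  have hexp (p : Ptd d) (hp : p ∈ hρ.toFinset) : h p =
      ∑ u : Finset (Fin d), (-1 : ℂ) ^ u.card *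
      ∫ η, (if p - ρ ≤ faceOffset u η then pderivU u h (ρ + faceOffset u η) else 0)
        ∂cubeMeasure d := by
    have hp' := (hρ.mem_toFinset.1 hp).2
    rw [← eq_sum_integral_pderivU hdiff hsm ρ (p := p - ρ)
      ⟨sub_nonneg.2 hp'.1, sub_le_iff_le_add'.2 hp'.2⟩, add_sub_cancel]
  rw [Finset.sum_congr rfl hexp, Finset.sum_comm]
  refine Finset.sum_congr rfl fun u _ => ?_
  rw [← Finset.mul_sum, ← integral_finsetSum _ fun p _ => integrable_ite_le_faceOffset u _
    (f := fun η => pderivU u h (ρ + faceOffset u η)) ((hsm u).comp (continuous_const.add (continuous_faceOffset u)))]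
  congr 1
  refine integral_congr_ae ((ae_cubeMeasure_mem d).mono fun η hη => ?_)
  exact (ncard_mul_eq_sum_ite hρ (faceOffset_mem u hη).2 _).symm

/-- The Koksma–Hlawka inequality on a single unit cube. -/
theorem norm_integral_sub_average_le {d : ℕ} {Λ : Set (Ptd d)}
    (hfin : ∀ ρ : Ptd d, (Λ ∩ Icc ρ (ρ + 1)).Finite) (hone : ∀ ρ : Ptd d, 1 ≤ nPtsD Λ ρ)
    {h : Ptd d → ℂ}
    (hdiff : ∀ u : Finset (Fin d), ∀ i : Fin d, ∀ x : Ptd d,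
      DifferentiableAt ℝ (fun t => pderivU u h (Function.update x i t)) (x i))
    (hsm : ∀ u : Finset (Fin d), Continuous (pderivU u h)) (ρ : Ptd d) :
    ‖∫ x, h (ρ + x) ∂cubeMeasure d - (∑ p ∈ (hfin ρ).toFinset, h p) / (nPtsD Λ ρ : ℂ)‖ ≤
      starDiscShiftD Λ * ∑ u ∈ (Finset.univ : Finset (Fin d)).powerset.erase ∅,
        ∫ η, ‖pderivU u h (ρ + faceOffset u η)‖ ∂cubeMeasure d := by
  have hN : (nPtsD Λ ρ : ℂ) ≠ 0 := Nat.cast_ne_zero.2 (Nat.one_le_iff_ne_zero.1 (hone ρ))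
  have hg (u : Finset (Fin d)) : Continuous fun η => pderivU u h (ρ + faceOffset u η) :=
    (hsm u).comp (continuous_const.add (continuous_faceOffset u))
  have hprod (u : Finset (Fin d)) : Integrable (fun η =>
      ((∏ i, faceOffset u η i : ℝ) : ℂ) * pderivU u h (ρ + faceOffset u η)) (cubeMeasure d) := by
    refine Continuous.integrable_cubeMeasure (.mul ?_ (hg u))
    exact Complex.continuous_ofReal.comp (continuous_finsetProd _ fun i _ =>
      (continuous_apply i).comp (continuous_faceOffset u))
  rw [integral_eq_sum_integral_pderivU hdiff hsm, sum_eq_sum_integral_pderivU hdiff hsm (hfin ρ),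
    Finset.sum_div, ← Finset.sum_sub_distrib, Finset.powerset_univ,
    ← Finset.add_sum_erase _ _ (Finset.mem_univ (∅ : Finset (Fin d)))]
  have hface : ∀ η : Ptd d, faceOffset ∅ η = 1 := fun η => by ext i; simp [faceOffset]
  have hzero : (-1 : ℂ) ^ (∅ : Finset (Fin d)).card *
        ∫ η, ((∏ i, faceOffset ∅ η i : ℝ) : ℂ) * pderivU ∅ h (ρ + faceOffset ∅ η) ∂cubeMeasure d -
      (-1 : ℂ) ^ (∅ : Finset (Fin d)).card *
        (∫ η, ((Λ ∩ Icc ρ (ρ + faceOffset ∅ η)).ncard : ℂ) * pderivU ∅ h (ρ + faceOffset ∅ η)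
          ∂cubeMeasure d) / (nPtsD Λ ρ : ℂ) = 0 := by
    have hN' := hN
    unfold nPtsD at hN' ⊢
    simp [hface, mul_div_cancel_left₀, hN']
  rw [hzero, zero_add, Finset.mul_sum]
  refine (norm_sum_le _ _).trans (Finset.sum_le_sum fun u _ => ?_)
  have hdisc : ∀ᵐ η ∂cubeMeasure d,
      ‖((∏ i, faceOffset u η i : ℝ) : ℂ) * pderivU u h (ρ + faceOffset u η) -
        ((Λ ∩ Icc ρ (ρ + faceOffset u η)).ncard : ℂ) * pderivU u h (ρ + faceOffset u η) /
          (nPtsD Λ ρ : ℂ)‖ ≤ starDiscShiftD Λ * ‖pderivU u h (ρ + faceOffset u η)‖ := by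
    filter_upwards [ae_cubeMeasure_mem d] with η hη
    rw [mul_div_right_comm, ← sub_mul, norm_mul]
    gcongr
    rw [norm_sub_rev]
    refine le_of_eq_of_le ?_ (abs_sub_prod_le_starDiscShiftD hfin ρ (faceOffset_mem u hη))
    rw [← Real.norm_eq_abs, ← Complex.norm_real]
    push_cast
    rfl
  rw [mul_div_assoc, ← mul_sub, norm_mul, norm_pow, norm_neg, norm_one, one_pow, one_mul,
    ← integral_div, ← integral_sub (hprod u) ((integrable_ncard_mul (hfin ρ) u (hg u)).div_const _),
    ← integral_const_mul]
  exact norm_integral_le_of_norm_le ((hg u).norm.integrable_cubeMeasure.const_mul _) hdisc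

theorem integrable_comp_add {d : ℕ} {g : Ptd d → ℂ} (hg : Integrable g) (hc : Continuous g)
    {φ : Ptd d → Ptd d} (hφ : Continuous φ) :
    Integrable (fun z : Ptd d × Ptd d => g (z.1 + φ z.2)) (volume.prod (cubeMeasure d)) := by
  have hm : Continuous fun z : Ptd d × Ptd d => g (z.1 + φ z.2) :=
    hc.comp (continuous_fst.add (hφ.comp continuous_snd))
  rw [integrable_prod_iff' hm.aestronglyMeasurable]
  refine ⟨.of_forall fun η => hg.comp_add_right (φ η), ?_⟩
  simp only [integral_add_right_eq_self (μ := (volume : Measure (Ptd d))) (fun x => ‖g x‖)]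
  exact integrable_const _

theorem integral_integral_comp_add {d : ℕ} {g : Ptd d → ℂ} (hg : Integrable g)
    (hc : Continuous g) {φ : Ptd d → Ptd d} (hφ : Continuous φ) :
    ∫ ρ, (∫ η, g (ρ + φ η) ∂cubeMeasure d) = ∫ x, g x := by
  rw [integral_integral_swap (f := fun ρ η => g (ρ + φ η)) (integrable_comp_add hg hc hφ)]
  simp only [integral_add_right_eq_self (μ := (volume : Measure (Ptd d))) g]
  simp

theorem integral_integral_norm_comp_add {d : ℕ} {g : Ptd d → ℂ} (hg : Integrable g)
    (hc : Continuous g) {φ : Ptd d → Ptd d} (hφ : Continuous φ) :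
    ∫ ρ, (∫ η, ‖g (ρ + φ η)‖ ∂cubeMeasure d) = ∫ x, ‖g x‖ := by
  rw [integral_integral_swap (f := fun ρ η => ‖g (ρ + φ η)‖) (integrable_comp_add hg hc hφ).norm]
  simp only [integral_add_right_eq_self (μ := (volume : Measure (Ptd d))) fun x => ‖g x‖]
  simp

theorem hasSum_indicator_div_mul {d : ℕ} {Λ : Set (Ptd d)} {ρ : Ptd d}
    (hρ : (Λ ∩ Icc ρ (ρ + 1)).Finite) {E : Type*} [Field E] [TopologicalSpace E]
    [IsTopologicalRing E] [Algebra ℝ E] (f : Ptd d → E) :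
    HasSum (fun p : Λ => algebraMap ℝ E
      ((Icc ρ (ρ + 1)).indicator (fun _ => (1 : ℝ)) (p : Ptd d) / (nPtsD Λ ρ : ℝ)) * f p)
      ((∑ p ∈ hρ.toFinset, f p) / (nPtsD Λ ρ : E)) := by
  set F : Ptd d → E := fun p => algebraMap ℝ E
    ((Icc ρ (ρ + 1)).indicator (fun _ => (1 : ℝ)) p / (nPtsD Λ ρ : ℝ)) * f p with hF
  change HasSum (F ∘ ((↑) : Λ → Ptd d)) _
  rw [hasSum_subtype_iff_indicator, Finset.sum_div]
  have hsum : ∑ p ∈ hρ.toFinset, f p / (nPtsD Λ ρ : E) =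
      ∑ p ∈ hρ.toFinset, Λ.indicator F p := by
    refine Finset.sum_congr rfl fun p hp => ?_
    have hp' := hρ.mem_toFinset.1 hp
    rw [indicator_of_mem hp'.1, hF]
    simp only [indicator_of_mem hp'.2, map_div₀, map_one, map_natCast]
    ring
  rw [hsum]
  refine hasSum_sum_of_ne_finset_zero fun p hp => ?_
  by_cases hpΛ : p ∈ Λ
  · have : p ∉ Icc ρ (ρ + 1) := fun h => hp (hρ.mem_toFinset.2 ⟨hpΛ, h⟩)
    rw [indicator_of_mem hpΛ, hF]
    simp only [indicator_of_notMem this]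
    simp
  · exact indicator_of_notMem hpΛ _

theorem measurable_indicator_Icc_add_one {d : ℕ} (p : Ptd d) :
    Measurable fun ρ : Ptd d => (Icc ρ (ρ + 1)).indicator (fun _ => (1 : ℝ)) p := by
  have : (fun ρ : Ptd d => (Icc ρ (ρ + 1)).indicator (fun _ => (1 : ℝ)) p) =
      (Icc (p - 1) p).indicator fun _ => 1 := by
    ext ρ
    refine indicator_eq_indicator ?_ rfl
    rw [mem_Icc, mem_Icc, sub_le_iff_le_add, and_comm]
  rw [this]
  exact measurable_const.indicator measurableSet_Icc

theorem measurable_nPtsD {d : ℕ} {Λ : Set (Ptd d)} (hcount : Λ.Countable)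
    (hfin : ∀ ρ : Ptd d, (Λ ∩ Icc ρ (ρ + 1)).Finite) :
    Measurable fun ρ : Ptd d => (nPtsD Λ ρ : ℝ) := by
  have := hcount.to_subtype
  have hN : (fun ρ : Ptd d => (nPtsD Λ ρ : ℝ)) = fun ρ => (∑' p : Λ,
      ENNReal.ofReal ((Icc ρ (ρ + 1)).indicator (fun _ => (1 : ℝ)) (p : Ptd d))).toReal := by
    ext ρ
    have hs : HasSum (fun p : Λ => (Icc ρ (ρ + 1)).indicator (fun _ => (1 : ℝ)) (p : Ptd d))
        (nPtsD Λ ρ : ℝ) := by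
      have hρ := hfin ρ
      change HasSum ((Icc ρ (ρ + 1)).indicator (fun _ => (1 : ℝ)) ∘ ((↑) : Λ → Ptd d)) _
      rw [hasSum_subtype_iff_indicator, indicator_indicator, nPtsD,
        ncard_eq_toFinset_card _ hρ, Finset.card_eq_sum_ones, Nat.cast_sum,
        Finset.sum_congr rfl fun p hp => (by
          rw [indicator_of_mem (hρ.mem_toFinset.1 hp)]; simp :
          ((1 : ℕ) : ℝ) = (Λ ∩ Icc ρ (ρ + 1)).indicator (fun _ => (1 : ℝ)) p)]
      exact hasSum_sum_of_ne_finset_zero fun p hp =>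
        indicator_of_notMem (fun h => hp (hρ.mem_toFinset.2 h)) _
    rw [← ENNReal.ofReal_tsum_of_nonneg (fun p => indicator_nonneg (fun _ _ => zero_le_one) _)
      hs.summable, hs.tsum_eq, ENNReal.toReal_ofReal (Nat.cast_nonneg _)]
  rw [hN]
  exact (Measurable.tsum fun p : Λ =>
    (measurable_indicator_Icc_add_one (p : Ptd d)).ennreal_ofReal).ennreal_toReal

/-- The cube averages of `h` over `Λ` are integrable, with integral the quadrature sum. -/
theorem integrable_average_and_integral_eq {d : ℕ} {Λ : Set (Ptd d)} (hcount : Λ.Countable)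
    (hfin : ∀ ρ : Ptd d, (Λ ∩ Icc ρ (ρ + 1)).Finite) (hone : ∀ ρ : Ptd d, 1 ≤ nPtsD Λ ρ)
    {h : Ptd d → ℂ} {B : Ptd d → ℝ} (hB : Integrable B)
    (hle : ∀ ρ : Ptd d, ∀ p ∈ Icc ρ (ρ + 1), ‖h p‖ ≤ B ρ) :
    Integrable (fun ρ => (∑ p ∈ (hfin ρ).toFinset, h p) / (nPtsD Λ ρ : ℂ)) ∧
      ∫ ρ, (∑ p ∈ (hfin ρ).toFinset, h p) / (nPtsD Λ ρ : ℂ) =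
        ∑' p : Λ, (qweightD Λ (p : Ptd d) : ℂ) * h p := by
  have := hcount.to_subtype
  set w : Λ → Ptd d → ℝ := fun p ρ =>
    (Icc ρ (ρ + 1)).indicator (fun _ => (1 : ℝ)) (p : Ptd d) / (nPtsD Λ ρ : ℝ) with hw
  have hw0 (p : Λ) (ρ : Ptd d) : 0 ≤ w p ρ :=
    div_nonneg (indicator_nonneg (fun _ _ => zero_le_one) _) (Nat.cast_nonneg _)
  have hwm (p : Λ) : Measurable (w p) :=
    (measurable_indicator_Icc_add_one _).div (measurable_nPtsD hcount hfin)
  have hFm (p : Λ) : AEStronglyMeasurable (fun ρ => (w p ρ : ℂ) * h p) volume :=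
    ((Complex.measurable_ofReal.comp (hwm p)).mul_const _).aestronglyMeasurable
  have hsum (ρ : Ptd d) : HasSum (fun p : Λ => (w p ρ : ℂ) * h p)
      ((∑ p ∈ (hfin ρ).toFinset, h p) / (nPtsD Λ ρ : ℂ)) :=
    hasSum_indicator_div_mul (hfin ρ) h
  have hsumn (ρ : Ptd d) : HasSum (fun p : Λ => w p ρ * ‖h p‖)
      ((∑ p ∈ (hfin ρ).toFinset, ‖h p‖) / (nPtsD Λ ρ : ℝ)) :=
    hasSum_indicator_div_mul (hfin ρ) fun p => ‖h p‖
  have hbound (ρ : Ptd d) : (∑ p ∈ (hfin ρ).toFinset, ‖h p‖) / (nPtsD Λ ρ : ℝ) ≤ B ρ := by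
    have hN : (0 : ℝ) < nPtsD Λ ρ := Nat.cast_pos.2 (hone ρ)
    rw [div_le_iff₀ hN, mul_comm, ← nsmul_eq_mul, nPtsD, ncard_eq_toFinset_card _ (hfin ρ)]
    exact Finset.sum_le_card_nsmul _ _ _ fun p hp => hle ρ p ((hfin ρ).mem_toFinset.1 hp).2
  have hlint : ∑' p : Λ, ∫⁻ ρ, ‖(w p ρ : ℂ) * h p‖ₑ ≠ ⊤ := by
    rw [← lintegral_tsum fun p => (hFm p).enorm]
    refine ne_top_of_le_ne_top hB.lintegral_lt_top.ne (lintegral_mono fun ρ => ?_)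
    have heq (p : Λ) : ‖(w p ρ : ℂ) * h p‖ₑ = ENNReal.ofReal (w p ρ * ‖h p‖) := by
      rw [← ofReal_norm, norm_mul, Complex.norm_real, Real.norm_of_nonneg (hw0 p ρ)]
    simp only [heq]
    rw [← ENNReal.ofReal_tsum_of_nonneg (fun p => mul_nonneg (hw0 p ρ) (norm_nonneg _))
      (hsumn ρ).summable, (hsumn ρ).tsum_eq]
    exact ENNReal.ofReal_le_ofReal (hbound ρ)
  constructor
  · refine hB.mono' ?_ (.of_forall fun ρ => ?_)
    · refine aestronglyMeasurable_of_tendsto_ae Filter.atTop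
        (f := fun (s : Finset Λ) ρ => ∑ p ∈ s, (w p ρ : ℂ) * h p)
        (fun s => Finset.aestronglyMeasurable_fun_sum s fun p _ => hFm p)
        (.of_forall fun ρ => ?_)
      have := hsum ρ
      rwa [HasSum, SummationFilter.unconditional_filter] at this
    · rw [norm_div, Complex.norm_natCast]
      exact (div_le_div_of_nonneg_right (norm_sum_le _ _) (Nat.cast_nonneg _)).trans (hbound ρ)
  · have := integral_tsum hFm hlint
    simp only [(hsum _).tsum_eq] at this
    rw [this]
    refine tsum_congr fun p => ?_
    rw [integral_mul_const, integral_complex_ofReal]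
    rfl

/-- Global Koksma–Hlawka inequality on `ℝ^d`. -/
theorem quadErr_le_dim (d : ℕ) (hd : 0 < d) (Λ : Set (Ptd d)) (hcount : Λ.Countable)
    (hfin : ∀ ρ : Ptd d, (Λ ∩ Icc ρ (ρ + 1)).Finite)
    (hone : ∀ ρ : Ptd d, 1 ≤ nPtsD Λ ρ)
    (h : Ptd d → ℂ) (hint : Integrable h) (hcont : Continuous h)
    (hdiff : ∀ u : Finset (Fin d), ∀ i : Fin d, ∀ x : Ptd d,
      DifferentiableAt ℝ (fun t => pderivU u h (Function.update x i t)) (x i))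
    (hsm : ∀ u : Finset (Fin d), Continuous (pderivU u h))
    (hintu : ∀ u : Finset (Fin d), Integrable (pderivU u h)) :
    ‖(∫ ρ : Ptd d, h ρ) - ∑' p : ↥Λ, (qweightD Λ (p : Ptd d) : ℂ) * h (p : Ptd d)‖ ≤
      starDiscShiftD Λ *
        ∑ u ∈ (Finset.univ : Finset (Fin d)).powerset.erase ∅,
          ∫ x : Ptd d, ‖pderivU u h x‖ := by
  have hface (u : Finset (Fin d)) := continuous_faceOffset u
  have hBint (u : Finset (Fin d)) : Integrable fun ρ : Ptd d =>
      ∫ η, ‖pderivU u h (ρ + faceOffset u η)‖ ∂cubeMeasure d :=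
    (integrable_comp_add (hintu u) (hsm u) (hface u)).norm.integral_prod_left
  obtain ⟨havg, havg_eq⟩ := integrable_average_and_integral_eq hcount hfin hone (h := h)
    (integrable_finsetSum Finset.univ fun u _ => hBint u) fun ρ p hp => by
      simpa using norm_le_sum_integral_norm_pderivU hdiff hsm ρ (p := p - ρ)
        ⟨sub_nonneg.2 hp.1, sub_le_iff_le_add'.2 hp.2⟩
  rw [← integral_integral_comp_add hint hcont continuous_id, ← havg_eq,
    ← integral_sub (integrable_comp_add hint hcont continuous_id).integral_prod_left havg]
  refine (norm_integral_le_of_norm_le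
    ((integrable_finsetSum _ fun u _ => hBint u).const_mul _)
    (.of_forall fun ρ => norm_integral_sub_average_le hfin hone hdiff hsm ρ)).trans_eq ?_
  rw [integral_const_mul, integral_finsetSum _ fun u _ => hBint u]
  congr 1
  exact Finset.sum_congr rfl fun u _ => integral_integral_norm_comp_add (hintu u) (hsm u) (hface u)
end
end
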